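/- arXiv:1905.11603 — 6 statements merged into one kernel-verified Lean document; each statement's English description precedes it below -/
import Mathlib

section
/- Let p be a prime, g ≥ 1, and let γ₀, γ ∈ GSp_{2g}(ℤ_p). Assume that the reduction modulo p of the characteristic polynomial of γ₀ is a separable polynomial over ℤ/pℤ (this is equivalent to the paper's hypothesis that p does not divide the Weyl discriminant D(γ₀)). Then there exists h ∈ GSp_{2g}(ℚ_p) with h⁻¹·γ₀·h = γ if and only if there exists k ∈ GSp_{2g}(ℤ_p) with k⁻¹·γ₀·k = γ. -/
open Matrix

/-- The standard symplectic matrix `J = [[0, -1], [1, 0]]` in `g × g` block form. -/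
def Jmat (R : Type*) [CommRing R] (g : ℕ) :
    Matrix (Fin g ⊕ Fin g) (Fin g ⊕ Fin g) R :=
  Matrix.fromBlocks 0 (-1) 1 0

variable (p : ℕ) [Fact p.Prime] (g : ℕ)

/-- `GSp_{2g}(ℤ_p)`: integral symplectic similitudes with unit multiplier. -/
def GSpZp : Set (Matrix (Fin g ⊕ Fin g) (Fin g ⊕ Fin g) ℤ_[p]) :=
  {A | ∃ η : ℤ_[p]ˣ, Aᵀ * Jmat ℤ_[p] g * A = (η : ℤ_[p]) • Jmat ℤ_[p] g}

/-- `GSp_{2g}(ℚ_p)`: invertible symplectic similitudes with nonzero multiplier. -/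
def GSpQp : Set (Matrix (Fin g ⊕ Fin g) (Fin g ⊕ Fin g) ℚ_[p]) :=
  {A | IsUnit A.det ∧ ∃ η : ℚ_[p], η ≠ 0 ∧ Aᵀ * Jmat ℚ_[p] g * A = η • Jmat ℚ_[p] g}

/-- Entrywise inclusion of integral matrices into `p`-adic matrices. -/
def matQp (A : Matrix (Fin g ⊕ Fin g) (Fin g ⊕ Fin g) ℤ_[p]) :
    Matrix (Fin g ⊕ Fin g) (Fin g ⊕ Fin g) ℚ_[p] :=
  A.map ((↑) : ℤ_[p] → ℚ_[p])

/-- `γ₀` and `γ` are conjugate by an element of `GSp_{2g}(ℚ_p)`. -/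
def ConjQp (γ₀ γ : Matrix (Fin g ⊕ Fin g) (Fin g ⊕ Fin g) ℤ_[p]) : Prop :=
  ∃ h ∈ GSpQp p g, h⁻¹ * matQp p g γ₀ * h = matQp p g γ

/-- Entrywise reduction modulo `pⁿ`. -/
noncomputable def πmod (n : ℕ) (A : Matrix (Fin g ⊕ Fin g) (Fin g ⊕ Fin g) ℤ_[p]) :
    Matrix (Fin g ⊕ Fin g) (Fin g ⊕ Fin g) (ZMod (p ^ n)) :=
  A.map (PadicInt.toZModPow n)

/-- `GSp_{2g}(ℤ/pⁿℤ)`: mod `pⁿ` symplectic similitudes with unit multiplier. -/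
def GSpMod (n : ℕ) : Set (Matrix (Fin g ⊕ Fin g) (Fin g ⊕ Fin g) (ZMod (p ^ n))) :=
  {A | ∃ η : (ZMod (p ^ n))ˣ, Aᵀ * Jmat (ZMod (p ^ n)) g * A = (η : ZMod (p ^ n)) • Jmat (ZMod (p ^ n)) g}

/-- `M(ℤ/pⁿℤ)_d`: similitudes mod `pⁿ` whose determinant is a unit times `pᵏ`, `k ≤ min d (n-1)`. -/
def Mmodd (n d : ℕ) : Set (Matrix (Fin g ⊕ Fin g) (Fin g ⊕ Fin g) (ZMod (p ^ n))) :=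
  {A | (∃ η : ZMod (p ^ n), Aᵀ * Jmat (ZMod (p ^ n)) g * A = η • Jmat (ZMod (p ^ n)) g) ∧
    ∃ u : (ZMod (p ^ n))ˣ, ∃ k : ℕ, k ≤ min d (n - 1) ∧
      A.det = (u : ZMod (p ^ n)) * (p : ZMod (p ^ n)) ^ k}

/-- The set `C_{(d,n)}(γ₀)` of elements of `GSp_{2g}(ℤ/pⁿℤ)` that are
`M(ℤ/pⁿℤ)_d`-conjugate to `γ₀ mod pⁿ`. -/
def Cdn (n d : ℕ) (γ₀ : Matrix (Fin g ⊕ Fin g) (Fin g ⊕ Fin g) ℤ_[p]) :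
    Set (Matrix (Fin g ⊕ Fin g) (Fin g ⊕ Fin g) (ZMod (p ^ n))) :=
  {γ | γ ∈ GSpMod p g n ∧ ∃ A ∈ Mmodd p g n d, A * γ = πmod p g n γ₀ * A}

/-- The characteristic polynomial of `γ₀`, viewed over `ℚ_p`, is separable
(i.e. `γ₀` is regular semisimple). -/
def RegSS (γ₀ : Matrix (Fin g ⊕ Fin g) (Fin g ⊕ Fin g) ℤ_[p]) : Prop :=
  ((matQp p g γ₀).charpoly).Separable

/-- A hermitian norm equation `c * u * σ u = f`, solved on the `σ`-stable direct factor `f`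
of `R`. -/
theorem exists_mul_involution_eq {R : Type*} [CommRing R] (σ : R →+* R)
    (hσ : ∀ x, σ (σ x) = x) (ϖ : R) (hσϖ : σ ϖ = ϖ) (hreg : ∀ x, ϖ * x = 0 → x = 0)
    (hjac : ∀ x w, x = ϖ * w * x → x = 0)
    (hidem : ∀ x, ∃ e y, e * e = e ∧ ϖ ∣ x - x * e ∧ ϖ ∣ e - x * y)
    (c d : R) (hcd : c * d = 1) (hσc : σ c = c) (k : ℕ) (f b : R) (hf : f * f = f) (hσf : σ f = f)
    (hb : c * (b * σ b) * f = ϖ ^ k * f) :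
    ∃ u, c * (u * σ u) * f = f := by
  induction k using Nat.strong_induction_on generalizing f b with
  | _ k ih =>
  rcases k with _ | k
  · exact ⟨b, by simpa using hb⟩
  obtain ⟨e₀, y, he₀, ⟨s, hs⟩, ⟨t, ht⟩⟩ := hidem (b * f)
  obtain ⟨e, he_def⟩ : ∃ e, e = e₀ * f := ⟨_, rfl⟩
  have he : e * e = e := by rw [he_def]; linear_combination f * f * he₀ + e₀ * hf
  have hef : e * f = e := by rw [he_def]; linear_combination e₀ * hf
  have hs' : b * f - b * e = ϖ * s := by
    rw [he_def]; linear_combination hs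
  have ht' : e = b * f * y + ϖ * (t * f) := by
    rw [he_def]; linear_combination f * ht + b * y * hf
  have hee : σ e * σ e = σ e := by rw [← map_mul, he]
  have hef' : σ e * f = σ e := by rw [← hσf, ← map_mul, hef]
  have hσt : σ e = σ b * f * σ y + ϖ * (σ t * f) := by
    conv_lhs => rw [ht']
    simp [hσf, hσϖ]
  have horth : e * σ e = 0 := by
    obtain ⟨w, hw⟩ : ∃ w, e * σ e = ϖ * w := by
      refine ⟨d * ϖ ^ k * f * (y * σ y) + t * f * σ e + b * f * y * (σ t * f), ?_⟩
      have h1 : e * σ e = b * f * y * (σ b * f * σ y) + ϖ * (t * f * σ e)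
          + b * f * y * (ϖ * (σ t * f)) := by
        linear_combination σ e * ht' + b * f * y * hσt
      have h2 : b * σ b * f = d * (ϖ ^ (k + 1) * f) := by
        linear_combination d * hb - b * σ b * f * hcd
      rw [h1]
      linear_combination f * y * σ y * h2 + d * ϖ ^ (k + 1) * (y * σ y) * hf
    apply hjac _ w
    linear_combination (e * σ e) * hw - σ e * σ e * he - e * hee
  obtain ⟨f₂, hf₂⟩ : ∃ f₂, f₂ = f - e - σ e := ⟨_, rfl⟩
  have hf₂f₂ : f₂ * f₂ = f₂ := by
    rw [hf₂]; linear_combination hf + he + hee - 2 * hef - 2 * hef' + 2 * horth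
  have hσf₂ : σ f₂ = f₂ := by
    rw [hf₂]; simp only [map_sub, hσf, hσ]; ring
  have hff₂ : f * f₂ = f₂ := by
    rw [hf₂]; linear_combination hf - hef - hef'
  have hef₂ : e * f₂ = 0 := by
    rw [hf₂]; linear_combination hef - he - horth
  have hσef₂ : σ e * f₂ = 0 := by
    rw [hf₂]; linear_combination hef' - hee - horth
  have hbf₂ : b * f₂ = ϖ * (s * f₂) := by
    linear_combination f₂ * hs' - b * hff₂ + b * hef₂
  have hσbf₂ : σ b * f₂ = ϖ * (σ s * f₂) := by
    simpa [hσf₂, hσϖ] using congrArg σ hbf₂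
  have hk : ϖ * (ϖ * (c * (s * σ s) * f₂) - ϖ ^ k * f₂) = 0 := by
    linear_combination f₂ * hb - c * σ b * f₂ * hbf₂ - c * ϖ * s * f₂ * hσbf₂
      - c * (b * σ b) * hff₂ + ϖ ^ (k + 1) * hff₂ + (c * b * σ b - c * ϖ ^ 2 * s * σ s) * hf₂f₂
  have hk' := hreg _ hk
  obtain ⟨u₂, hu₂⟩ : ∃ u, c * (u * σ u) * f₂ = f₂ := by
    rcases k with _ | k
    · refine ⟨0, ?_⟩
      have : f₂ = 0 := hjac _ (c * (s * σ s)) (by linear_combination -hk')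
      simp [this]
    · refine ih k (by omega) f₂ s hf₂f₂ hσf₂ ?_
      have : ϖ * (c * (s * σ s) * f₂ - ϖ ^ k * f₂) = 0 := by linear_combination hk'
      exact sub_eq_zero.1 (hreg _ this)
  have hσd : σ d = d := by
    have : c * σ d = 1 := by rw [← hσc, ← map_mul, hcd, map_one]
    linear_combination d * this - σ d * hcd
  refine ⟨e + σ e * d + f₂ * u₂, ?_⟩
  simp only [map_add, map_mul, hσ, hσf₂, hσd]
  have h1 : c * ((e + σ e * d + f₂ * u₂) * (σ e + e * d + f₂ * σ u₂))
      = e + σ e + c * (u₂ * σ u₂) * f₂ := by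
    linear_combination c * (1 + d * d) * horth + c * d * he + c * d * hee
      + c * u₂ * σ u₂ * hf₂f₂ + (e + σ e) * hcd + (c * σ u₂ + c * u₂ * d) * hef₂
      + (c * d * σ u₂ + c * u₂) * hσef₂
  rw [h1, hu₂, hf₂]
  linear_combination hf

open Polynomial in
theorem map_aeval_matrix {n R S : Type*} [Fintype n] [DecidableEq n] [CommRing R] [CommRing S]
    (φ : R →+* S) (A : Matrix n n R) (q : R[X]) :
    (aeval A q).map φ = aeval (A.map φ) (q.map φ) := by
  refine map_aeval_eq_aeval_map (φ := φ) (ψ := φ.mapMatrix (m := n)) ?_ q A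
  ext a i j
  simp [Matrix.algebraMap_matrix_apply, apply_ite φ]

open Polynomial in
theorem charpoly_dvd_of_aeval_eq_zero {n F : Type*} [Fintype n] [DecidableEq n] [Field F]
    {A : Matrix n n F} (hA : A.charpoly.Separable) {q : F[X]} (hq : aeval A q = 0) :
    A.charpoly ∣ q := by
  let K := AlgebraicClosure F
  rw [← Polynomial.map_dvd_map' (algebraMap F K)]
  rcases eq_or_ne q 0 with rfl | hq0
  · simp
  have hsplit : (A.charpoly.map (algebraMap F K)).Splits := IsAlgClosed.splits _
  refine (hsplit.dvd_iff_roots_le_roots (A.charpoly_monic.map _).ne_zero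
    (by simpa using hq0)).2 ?_
  rw [Multiset.le_iff_subset (nodup_roots hA.map)]
  intro μ hμ
  have hq0' : q.map (algebraMap F K) ≠ 0 := by simpa using hq0
  rw [mem_roots hq0']
  have hμ' := isRoot_of_mem_roots hμ
  rw [← Matrix.charpoly_map] at hμ'
  have hspec := Matrix.mem_spectrum_of_isRoot_charpoly hμ'
  have h0 : aeval (A.map (algebraMap F K)) (q.map (algebraMap F K)) = 0 := by
    rw [← map_aeval_matrix, hq]; simp
  have := spectrum.subset_polynomial_aeval (A.map (algebraMap F K)) (q.map (algebraMap F K))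
    ⟨μ, hspec, rfl⟩
  rw [h0] at this
  by_contra hne
  rw [spectrum.mem_iff, sub_zero] at this
  exact this ((IsUnit.mk0 _ hne).map (algebraMap K _))

open Polynomial Module LinearMap in
theorem exists_cyclic_vector {n F : Type*} [Fintype n] [DecidableEq n] [Field F]
    {A : Matrix n n F} (hA : A.charpoly.Separable) :
    ∃ v : n → F, ∀ q : F[X], aeval A q *ᵥ v = 0 → A.charpoly ∣ q := by
  obtain ⟨x, hx⟩ := exists_ker_toSpanSingleton_eq_annihilator F[X] (AEval' (Matrix.toLin' A))
  obtain ⟨v, rfl⟩ := (AEval'.of (Matrix.toLin' A)).surjective x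
  refine ⟨v, fun q hq => charpoly_dvd_of_aeval_eq_zero hA ?_⟩
  have hmem : q ∈ ker (toSpanSingleton F[X] _ (AEval'.of (Matrix.toLin' A) v)) := by
    rw [mem_ker, toSpanSingleton_apply, ← AEval.of_aeval_smul]
    have : aeval (Matrix.toLin' A) q = Matrix.toLin' (aeval A q) :=
      aeval_algHom_apply (Matrix.toLinAlgEquiv' : Matrix n n F ≃ₐ[F] _).toAlgHom A q
    rw [this, Module.End.smul_def, Matrix.toLin'_apply, hq, map_zero]
  rw [hx, ← span_minpoly_eq_annihilator, Ideal.mem_span_singleton,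
    Matrix.minpoly_toLin'] at hmem
  obtain ⟨r, rfl⟩ := hmem
  simp [minpoly.aeval]

open Polynomial in
theorem exists_pow_succ_eq {n F : Type*} [Fintype n] [DecidableEq n] [Field F] [Finite F]
    {A : Matrix n n F} (hA : Squarefree A.charpoly) (q : F[X]) :
    ∃ m, aeval A q ^ (m + 2) = aeval A q := by
  obtain ⟨i, j, hij, h⟩ := Finite.exists_ne_map_eq_of_infinite (fun i : ℕ => aeval A q ^ i)
  wlog hlt : i < j generalizing i j
  · exact this j i hij.symm h.symm (by omega)
  obtain ⟨m, rfl⟩ := Nat.exists_eq_add_of_lt hlt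
  have hrad : IsRadical (minpoly F A) :=
    (hA.squarefree_of_dvd (Matrix.minpoly_dvd_charpoly A)).isRadical
  have hdvd : minpoly F A ∣ (q ^ (m + 2) - q) ^ (i + 1) := by
    apply minpoly.dvd
    have h1 : (q ^ (m + 2) - q) ^ (i + 1)
        = (q ^ (i + m + 1) - q ^ i) * (q * (q ^ (m + 1) - 1) ^ i) := by
      have : q ^ (m + 2) - q = q * (q ^ (m + 1) - 1) := by ring
      rw [this, mul_pow]; ring
    rw [h1, map_mul]
    simp only [map_sub, map_pow]
    rw [← h, sub_self, zero_mul]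
  refine ⟨m, ?_⟩
  have := (minpoly.dvd_iff).1 (hrad _ _ hdvd)
  simpa [sub_eq_zero] using this

/-- The matrix whose columns are `v, A v, A² v, …`. -/
noncomputable def krylov {n R : Type*} [Fintype n] [DecidableEq n] [CommRing R]
    (A : Matrix n n R) (v : n → R) : Matrix n n R :=
  Matrix.of fun i j => (A ^ (Fintype.equivFin n j : ℕ) *ᵥ v) i

section krylov

variable {n R : Type*} [Fintype n] [CommRing R]

open Polynomial

theorem exists_coeff_eq (w : n → R) : ∃ q : R[X], q.degree < Fintype.card n ∧
    (fun j => q.coeff (Fintype.equivFin n j)) = w := by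
  refine ⟨((degreeLTEquiv R (Fintype.card n)).symm (w ∘ (Fintype.equivFin n).symm) : R[X]),
    mem_degreeLT.1 (Subtype.prop _), ?_⟩
  ext j
  have := congrFun ((degreeLTEquiv R (Fintype.card n)).apply_symm_apply
    (w ∘ (Fintype.equivFin n).symm)) (Fintype.equivFin n j)
  simpa [degreeLTEquiv] using this

variable [DecidableEq n]

theorem krylov_mulVec_coeff (A : Matrix n n R) (v : n → R) {q : R[X]}
    (hq : q.degree < Fintype.card n) :
    krylov A v *ᵥ (fun j => q.coeff (Fintype.equivFin n j)) = aeval A q *ᵥ v := by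
  rcases eq_or_ne q 0 with rfl | hq0
  · simp [← Pi.zero_def]
  have h : aeval A q = ∑ j : n, q.coeff (Fintype.equivFin n j) •
      A ^ (Fintype.equivFin n j : ℕ) := by
    rw [(Fintype.equivFin n).sum_comp (fun i => q.coeff i • A ^ (i : ℕ)),
      Fin.sum_univ_eq_sum_range (fun i => q.coeff i • A ^ i), aeval_def,
      eval₂_eq_sum_range' _ (n := Fintype.card n)]
    · simp [Algebra.smul_def]
    · rwa [natDegree_lt_iff_degree_lt hq0]
  rw [h, Matrix.sum_mulVec]
  ext i
  simp [Matrix.mulVec_apply, Finset.sum_apply, krylov, Matrix.smul_mulVec, mul_comm, dotProduct]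

theorem krylov_map {S : Type*} [CommRing S] (φ : R →+* S) (A : Matrix n n R) (v : n → R) :
    (krylov A v).map φ = krylov (A.map φ) (φ ∘ v) := by
  ext i j
  have : A.map φ ^ (Fintype.equivFin n j : ℕ) = (A ^ (Fintype.equivFin n j : ℕ)).map φ :=
    (map_pow φ.mapMatrix A _).symm
  simp [krylov, this, RingHom.map_mulVec]

theorem exists_eq_aeval_mulVec {A : Matrix n n R} {v : n → R} (hv : IsUnit (krylov A v).det)
    (w : n → R) : ∃ q : R[X], w = aeval A q *ᵥ v := by
  obtain ⟨q, hq, hw⟩ := exists_coeff_eq ((krylov A v)⁻¹ *ᵥ w)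
  refine ⟨q, ?_⟩
  rw [← krylov_mulVec_coeff A v hq, hw, Matrix.mulVec_mulVec, Matrix.mul_nonsing_inv _ hv,
    Matrix.one_mulVec]

theorem exists_eq_aeval_of_commute {A : Matrix n n R} {v : n → R}
    (hv : IsUnit (krylov A v).det) {B : Matrix n n R} (hB : Commute A B) :
    ∃ q : R[X], B = aeval A q := by
  obtain ⟨q, hq⟩ := exists_eq_aeval_mulVec hv (B *ᵥ v)
  refine ⟨q, Matrix.ext_of_mulVec_single fun i => ?_⟩
  obtain ⟨r, hr⟩ := exists_eq_aeval_mulVec hv (Pi.single i 1)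
  have hc : Commute B (aeval A r) := by
    clear hr
    induction r using Polynomial.induction_on' with
    | add r s hr hs => simpa using hr.add_right hs
    | monomial k a =>
      rw [aeval_monomial]
      exact (Algebra.commute_algebraMap_right a B).mul_right (hB.symm.pow_right k)
  rw [hr, Matrix.mulVec_mulVec, hc.eq, ← Matrix.mulVec_mulVec, hq, Matrix.mulVec_mulVec,
    Matrix.mulVec_mulVec, ← map_mul, ← map_mul, mul_comm]

theorem exists_conj_of_charpoly_eq {A B : Matrix n n R} {v w : n → R}
    (hv : IsUnit (krylov A v).det) (hw : IsUnit (krylov B w).det)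
    (h : A.charpoly = B.charpoly) : ∃ K : Matrix n n R, IsUnit K.det ∧ B * K = K * A := by
  nontriviality R
  refine ⟨krylov B w * (krylov A v)⁻¹, ?_, ?_⟩
  · rw [Matrix.det_mul]
    exact hw.mul (Matrix.isUnit_nonsing_inv_det _ hv)
  have key (q : R[X]) : (krylov B w * (krylov A v)⁻¹) *ᵥ (aeval A q *ᵥ v) = aeval B q *ᵥ w := by
    have hdeg : (q %ₘ A.charpoly).degree < Fintype.card n := by
      rw [← Matrix.charpoly_degree_eq_dim A]
      exact degree_modByMonic_lt _ A.charpoly_monic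
    rw [← aeval_modByMonic_eq_self_of_root (Matrix.aeval_self_charpoly A),
      ← aeval_modByMonic_eq_self_of_root (Matrix.aeval_self_charpoly B), ← h,
      ← krylov_mulVec_coeff A v hdeg, ← krylov_mulVec_coeff B w hdeg, Matrix.mulVec_mulVec,
      mul_assoc, Matrix.nonsing_inv_mul _ hv, mul_one]
  refine Matrix.ext_of_mulVec_single fun i => ?_
  obtain ⟨r, hr⟩ := exists_eq_aeval_mulVec hv (Pi.single i 1)
  rw [hr, ← Matrix.mulVec_mulVec, key, ← Matrix.mulVec_mulVec, Matrix.mulVec_mulVec _ A]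
  have := key (X * r)
  simp only [map_mul, aeval_X] at this
  rw [this, Matrix.mulVec_mulVec]

end krylov

open Polynomial in
theorem exists_krylov_det_isUnit {p : ℕ} [Fact p.Prime] {n : Type*} [Fintype n] [DecidableEq n]
    {A : Matrix n n ℤ_[p]} (hA : (A.charpoly.map (PadicInt.toZMod (p := p))).Separable) :
    ∃ v, IsUnit (krylov A v).det := by
  rw [← Matrix.charpoly_map] at hA
  obtain ⟨v', hv'⟩ := exists_cyclic_vector hA
  obtain ⟨v, rfl⟩ : ∃ v : n → ℤ_[p], PadicInt.toZMod (p := p) ∘ v = v' :=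
    (ZMod.ringHom_surjective (PadicInt.toZMod (p := p))).comp_left v'
  refine ⟨v, isUnit_of_map_unit (PadicInt.toZMod (p := p)) _ ?_⟩
  rw [RingHom.map_det, RingHom.mapMatrix_apply, krylov_map, isUnit_iff_ne_zero]
  intro h0
  obtain ⟨w, hw0, hw⟩ := Matrix.exists_mulVec_eq_zero_iff.2 h0
  obtain ⟨q, hq, rfl⟩ := exists_coeff_eq w
  rw [krylov_mulVec_coeff _ _ hq] at hw
  have hq0 : q = 0 := by
    refine eq_zero_of_dvd_of_degree_lt (hv' q hw) ?_
    rwa [Matrix.charpoly_degree_eq_dim]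
  exact hw0 (by ext; simp [hq0])

section padic

variable {p : ℕ} [Fact p.Prime] {n : Type*}

theorem exists_eq_smul_of_map_toZMod_eq_zero {x : Matrix n n ℤ_[p]}
    (hx : x.map (PadicInt.toZMod (p := p)) = 0) : ∃ z, x = (p : ℤ_[p]) • z := by
  have h (i j) : (p : ℤ_[p]) ∣ x i j := by
    rw [← Ideal.mem_span_singleton, ← PadicInt.maximalIdeal_eq_span_p, ← PadicInt.ker_toZMod,
      RingHom.mem_ker]
    exact congrFun (congrFun hx i) j
  choose z hz using h
  exact ⟨Matrix.of z, by ext i j; simp [hz i j]⟩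

theorem eq_of_natCast_smul_eq {x y : Matrix n n ℤ_[p]}
    (h : (p : ℤ_[p]) • x = (p : ℤ_[p]) • y) : x = y := by
  have hp : (p : ℤ_[p]) ≠ 0 := by exact_mod_cast (Fact.out : p.Prime).ne_zero
  ext i j
  simpa [hp] using congrFun (congrFun h i) j

theorem eq_zero_of_forall_eq_pow_smul {x : Matrix n n ℤ_[p]}
    (h : ∀ m : ℕ, ∃ y, x = (p : ℤ_[p]) ^ m • y) : x = 0 := by
  ext i j
  by_contra hne
  have hne' : x i j ≠ 0 := hne
  have hfin : FiniteMultiplicity (p : ℤ_[p]) (x i j) :=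
    FiniteMultiplicity.of_prime_left PadicInt.prime_p hne'
  obtain ⟨m, hm⟩ := hfin
  obtain ⟨y, hy⟩ := h (m + 1)
  exact hm ⟨y i j, by rw [hy]; simp⟩

variable [Fintype n] [DecidableEq n]

theorem eq_zero_of_eq_smul_mul {x w : Matrix n n ℤ_[p]}
    (h : x = (p : ℤ_[p]) • (w * x)) : x = 0 := by
  have hdet : IsUnit (1 - (p : ℤ_[p]) • w).det := by
    refine isUnit_of_map_unit (PadicInt.toZMod (p := p)) _ ?_
    have : (PadicInt.toZMod (p := p)).mapMatrix (1 - (p : ℤ_[p]) • w) = 1 := by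
      rw [map_sub, map_one, sub_eq_self]
      ext i j
      simp
    rw [RingHom.map_det, this, Matrix.det_one]
    exact isUnit_one
  have h0 : (1 - (p : ℤ_[p]) • w) * x = 0 := by
    rw [sub_mul, one_mul, smul_mul_assoc, ← h, sub_self]
  rw [← Matrix.nonsing_inv_mul_cancel_left _ x hdet, h0, mul_zero]

/-- Idempotents modulo `p` lift within the centralizer of `A`. -/
theorem exists_idempotent_lift {A x : Matrix n n ℤ_[p]} (hAx : Commute A x)
    {y : Matrix n n ℤ_[p]} (hxy : x * x - x = (p : ℤ_[p]) • y) :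
    ∃ e, Commute A e ∧ e * e = e ∧ ∃ z, e - x = (p : ℤ_[p]) • z := by
  let T (m : ℕ) : Set (Matrix n n ℤ_[p]) :=
    {e | A * e = e * A} ∩ ({e | ∃ y, e * e - e = (p : ℤ_[p]) ^ (m + 1) • y} ∩
      {e | ∃ z, e - x = (p : ℤ_[p]) • z})
  have : CompactSpace (Matrix n n ℤ_[p]) := inferInstanceAs (CompactSpace (n → n → ℤ_[p]))
  have hclosed (a : ℤ_[p]) : IsClosed {d : Matrix n n ℤ_[p] | ∃ y, d = a • y} := by
    have : {d : Matrix n n ℤ_[p] | ∃ y, d = a • y} =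
        Set.range (fun y : Matrix n n ℤ_[p] => a • y) := by
      ext d; simp [eq_comm]
    rw [this]
    exact (isCompact_range (continuous_const_smul a)).isClosed
  have hT (m : ℕ) : IsClosed (T m) := by
    refine IsClosed.inter (isClosed_eq (by fun_prop) (by fun_prop)) (IsClosed.inter ?_ ?_)
    · exact (hclosed (p ^ (m + 1))).preimage
        (f := fun e : Matrix n n ℤ_[p] => e * e - e) (by fun_prop)
    · exact (hclosed p).preimage (f := fun e : Matrix n n ℤ_[p] => e - x) (by fun_prop)
  have hne (m : ℕ) : (T m).Nonempty := by
    induction m with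
    | zero => exact ⟨x, hAx, ⟨y, by simpa using hxy⟩, 0, by simp⟩
    | succ m ih =>
      obtain ⟨e, hAe, ⟨y, hy⟩, z, hz⟩ := ih
      have hAe' : Commute A e := hAe
      refine ⟨3 • (e * e) - 2 • (e * e * e), ?_, ⟨(p : ℤ_[p]) ^ m •
        ((4 • (e * e - e) - 3) * (y * y)), ?_⟩, z + (1 - 2 • e) * ((p : ℤ_[p]) ^ m • y), ?_⟩
      · exact (((hAe'.mul_right hAe').smul_right 3).sub_right
          (((hAe'.mul_right hAe').mul_right hAe').smul_right 2)).eq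
      · have h1 : (3 • (e * e) - 2 • (e * e * e)) * (3 • (e * e) - 2 • (e * e * e))
            - (3 • (e * e) - 2 • (e * e * e))
            = (4 • (e * e - e) - 3) * ((e * e - e) * (e * e - e)) := by noncomm_ring
        rw [h1]
        conv_lhs => enter [2]; rw [hy]
        simp only [smul_mul_assoc, mul_smul_comm, smul_smul]
        congr 1
        ring
      · have h1 : 3 • (e * e) - 2 • (e * e * e) - x
            = (e - x) + (1 - 2 • e) * (e * e - e) := by noncomm_ring
        rw [h1, hz, hy]
        simp only [smul_add, mul_smul_comm, smul_smul, pow_succ']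
  obtain ⟨e, he⟩ := IsCompact.nonempty_iInter_of_sequence_nonempty_isCompact_isClosed T
    (fun m e ⟨h1, ⟨y, hy⟩, h3⟩ => ⟨h1, ⟨(p : ℤ_[p]) • y, by rw [hy, smul_smul, pow_succ]⟩, h3⟩)
    hne (hT 0).isCompact hT
  rw [Set.mem_iInter] at he
  refine ⟨e, (he 0).1, sub_eq_zero.1 (eq_zero_of_forall_eq_pow_smul fun m => ?_), (he 0).2.2⟩
  obtain ⟨y, hy⟩ := (he m).2.1
  exact ⟨(p : ℤ_[p]) • y, by rw [hy, smul_smul, pow_succ]⟩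

section similitude

variable {R : Type*} [CommRing R] {J γ x : Matrix n n R} {η : Rˣ}

theorem isUnit_of_transpose_mul_mul_eq (hJ : J * J = -1) (hγ : γᵀ * J * γ = (η : R) • J) :
    IsUnit γ := by
  refine IsUnit.of_mul_eq_one_right ((↑η⁻¹ : R) • (-J * (γᵀ * J))) ?_
  rw [smul_mul_assoc, mul_assoc, hγ, mul_smul_comm, smul_smul, neg_mul, hJ]
  simp

theorem isUnit_transpose_mul (hJ : J * J = -1) (hγ : γᵀ * J * γ = (η : R) • J) :
    IsUnit (γᵀ * J) :=
  ((Matrix.isUnit_transpose γ).2 (isUnit_of_transpose_mul_mul_eq hJ hγ)).mul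
    (IsUnit.of_mul_eq_one_right (-J) (by simp [hJ]))

theorem commute_symplecticAdjoint (hJ : J * J = -1) (hγ : γᵀ * J * γ = (η : R) • J)
    (hx : Commute γ x) :
    Commute γ (-(J * xᵀ * J)) := by
  have hx' : γᵀ * xᵀ = xᵀ * γᵀ := by
    rw [← Matrix.transpose_mul, ← Matrix.transpose_mul, hx.eq]
  have h : (γᵀ * J) * (γ * (J * xᵀ * J)) = (γᵀ * J) * ((J * xᵀ * J) * γ) := by
    calc _ = (γᵀ * J * γ) * J * xᵀ * J := by noncomm_ring
      _ = (η : R) • ((J * J) * xᵀ * J) := by rw [hγ]; simp only [smul_mul_assoc]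
      _ = -(xᵀ * ((η : R) • J)) := by rw [hJ]; simp
      _ = -((xᵀ * γᵀ) * J * γ) := by rw [← hγ]; noncomm_ring
      _ = γᵀ * (J * J) * xᵀ * J * γ := by rw [← hx', hJ]; noncomm_ring
      _ = _ := by noncomm_ring
  refine Commute.neg_right ?_
  exact (isUnit_transpose_mul hJ hγ).mul_left_cancel h

end similitude

theorem exists_commute_idempotent {A x : Matrix n n ℤ_[p]}
    (hA : (A.charpoly.map (PadicInt.toZMod (p := p))).Separable) (hx : Commute A x) :
    ∃ e y z z', Commute A e ∧ Commute A y ∧ e * e = e ∧ x - x * e = (p : ℤ_[p]) • z ∧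
      e - x * y = (p : ℤ_[p]) • z' := by
  obtain ⟨v, hv⟩ := exists_krylov_det_isUnit hA
  obtain ⟨q, hq⟩ := exists_eq_aeval_of_commute hv hx
  obtain ⟨m, hm⟩ := exists_pow_succ_eq (A := A.map (PadicInt.toZMod (p := p)))
    (by rw [Matrix.charpoly_map]; exact hA.squarefree) (q.map (PadicInt.toZMod (p := p)))
  obtain ⟨z, hz⟩ : ∃ z, x ^ (m + 2) - x = (p : ℤ_[p]) • z := by
    refine exists_eq_smul_of_map_toZMod_eq_zero ?_
    change (PadicInt.toZMod (p := p)).mapMatrix _ = 0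
    rw [map_sub, map_pow, hq, RingHom.mapMatrix_apply, map_aeval_matrix, hm, sub_self]
  obtain ⟨e, hAe, hee, z', hz'⟩ := exists_idempotent_lift (hx.pow_right (m + 1))
    (y := z * x ^ m) (by
      rw [← smul_mul_assoc, ← hz, sub_mul, ← pow_add, ← pow_add, ← pow_succ',
        show m + 1 + (m + 1) = m + 2 + m by omega])
  refine ⟨e, x ^ m, -z - x * z', z', hAe, hx.pow_right m, hee, ?_, ?_⟩
  · rw [smul_sub, smul_neg, ← hz, ← mul_smul_comm, ← hz']
    rw [mul_sub, ← pow_succ']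
    abel
  · rw [← hz', pow_succ']

/-- Two alternating forms invariant up to the multiplier of `γ` that are isometric up to `pᵏ` via a
possibly singular element of the centralizer of `γ` are similar via a centralizing matrix. -/
theorem exists_commute_transpose_mul_eq {J γ c b : Matrix n n ℤ_[p]} {η w : ℤ_[p]ˣ} {k : ℕ}
    (hsep : (γ.charpoly.map (PadicInt.toZMod (p := p))).Separable)
    (hJ : J * J = -1) (hJt : Jᵀ = -J) (hγ : γᵀ * J * γ = (η : ℤ_[p]) • J)
    (hc : Commute γ c) (hcdet : IsUnit c.det) (hcJ : (J * c)ᵀ = -(J * c)) (hb : Commute γ b)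
    (hbc : bᵀ * (J * c) * b = ((w : ℤ_[p]) * (p : ℤ_[p]) ^ k) • J) :
    ∃ u, Commute γ u ∧ uᵀ * (J * c) * u = (w : ℤ_[p]) • J := by
  obtain ⟨v, hv⟩ := exists_krylov_det_isUnit hsep
  let S := Subalgebra.centralizer ℤ_[p] {γ}
  have hmem {x : Matrix n n ℤ_[p]} : x ∈ S ↔ Commute γ x := by
    simp [S, Subalgebra.mem_centralizer_iff, Commute, SemiconjBy]
  have hcomm (x y : S) : x * y = y * x := by
    obtain ⟨q, hq⟩ := exists_eq_aeval_of_commute hv (hmem.1 x.2)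
    obtain ⟨r, hr⟩ := exists_eq_aeval_of_commute hv (hmem.1 y.2)
    ext1
    simp only [Subalgebra.coe_mul, hq, hr, ← map_mul, mul_comm]
  let _ : CommRing S := { (inferInstance : Ring S) with mul_comm := hcomm }
  let σ : S →+* S :=
    { toFun := fun x => ⟨-(J * (x : Matrix n n ℤ_[p])ᵀ * J),
        hmem.2 (commute_symplecticAdjoint hJ hγ (hmem.1 x.2))⟩
      map_one' := by ext1; simp [hJ]
      map_zero' := by ext1; simp
      map_add' := fun x y => by ext1; simp [mul_add, add_mul, add_comm]
      map_mul' := fun x y => by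
        rw [hcomm x y]
        ext1
        simp only [Subalgebra.coe_mul, Matrix.transpose_mul]
        calc _ = J * (x : Matrix n n ℤ_[p])ᵀ * (-1) * (y : Matrix n n ℤ_[p])ᵀ * J := by
              noncomm_ring
          _ = _ := by rw [← hJ]; noncomm_ring }
  have hσ (x : S) : ((σ x : S) : Matrix n n ℤ_[p]) = -(J * (x : Matrix n n ℤ_[p])ᵀ * J) := rfl
  have hp (x : S) : (((p : S) * x : S) : Matrix n n ℤ_[p]) = (p : ℤ_[p]) •
      (x : Matrix n n ℤ_[p]) := by
    simp [← nsmul_eq_mul, Nat.cast_smul_eq_nsmul]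
  have hdvd {s : S} {z : Matrix n n ℤ_[p]} (h : (s : Matrix n n ℤ_[p]) = (p : ℤ_[p]) • z) :
      (p : S) ∣ s := by
    have hz : Commute γ z := by
      apply eq_of_natCast_smul_eq (p := p)
      rw [← mul_smul_comm, ← smul_mul_assoc, ← h]
      exact hmem.1 s.2
    exact ⟨⟨z, hmem.2 hz⟩, Subtype.ext (by rw [hp, h])⟩
  have hcinv : Commute γ c⁻¹ := by
    have := hc.eq
    calc γ * c⁻¹ = c⁻¹ * (c * γ) * c⁻¹ := by
          rw [Matrix.nonsing_inv_mul_cancel_left _ _ hcdet]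
      _ = c⁻¹ * γ := by
          rw [← this, mul_assoc, Matrix.mul_nonsing_inv_cancel_right _ _ hcdet]
  have hcσ : -(J * cᵀ * J) = c := by
    rw [Matrix.transpose_mul, hJt] at hcJ
    have : cᵀ * J = J * c := by simpa using hcJ
    rw [mul_assoc, this, ← mul_assoc, hJ]; simp
  obtain ⟨u, hu⟩ := exists_mul_involution_eq σ
    (fun x => by
      ext1
      simp only [hσ, Matrix.transpose_neg, Matrix.transpose_mul, Matrix.transpose_transpose, hJt]
      calc _ = (J * J) * (x : Matrix n n ℤ_[p]) * (J * J) := by noncomm_ring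
        _ = _ := by rw [hJ]; simp)
    (p : S) (map_natCast σ p)
    (fun x hx => by
      have := congrArg (Subtype.val) hx
      rw [hp] at this
      exact Subtype.ext (eq_of_natCast_smul_eq (this.trans (smul_zero _).symm)))
    (fun x w hx => by
      have := congrArg (Subtype.val) hx
      rw [mul_assoc, hp] at this
      exact Subtype.ext (eq_zero_of_eq_smul_mul this))
    (fun x => by
      obtain ⟨e, y, z, z', hAe, hAy, he, hz, hz'⟩ :=
        exists_commute_idempotent hsep (hmem.1 x.2)
      exact ⟨⟨e, hmem.2 hAe⟩, ⟨y, hmem.2 hAy⟩, Subtype.ext he, hdvd (z := z) hz,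
        hdvd (z := z') hz'⟩)
    ((↑w⁻¹ : ℤ_[p]) • ⟨c, hmem.2 hc⟩) ((w : ℤ_[p]) • ⟨c⁻¹, hmem.2 hcinv⟩)
    (Subtype.ext (by simp [smul_smul, Matrix.mul_nonsing_inv _ hcdet]))
    (Subtype.ext (by
      rw [hσ, Subalgebra.coe_smul, Matrix.transpose_smul, mul_smul_comm, smul_mul_assoc,
        ← smul_neg, hcσ]))
    k 1 ⟨b, hmem.2 hb⟩ (one_mul _) (map_one _) (by
      rw [mul_one, mul_one, mul_comm (⟨b, hmem.2 hb⟩ : S), mul_left_comm]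
      ext1
      simp only [Subalgebra.coe_mul, Subalgebra.coe_smul, hσ, smul_mul_assoc, mul_smul_comm]
      rw [neg_mul, show J * bᵀ * J * (c * b) = J * (bᵀ * (J * c) * b) by noncomm_ring, hbc]
      simp only [mul_smul_comm, hJ, smul_neg, neg_neg]
      rw [smul_smul, ← mul_assoc, Units.inv_mul, one_mul]
      rw [Subalgebra.coe_pow, show ((p : S) : Matrix n n ℤ_[p]) = p from map_natCast S.val p]
      simp [Algebra.smul_def])
  refine ⟨u, hmem.1 u.2, ?_⟩
  rw [mul_one, mul_comm u, mul_left_comm] at hu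
  have hu' := congrArg (fun x : S => (w : ℤ_[p]) • (J * (x : Matrix n n ℤ_[p]))) hu
  simp only [Subalgebra.coe_mul, Subalgebra.coe_smul, Subalgebra.coe_one, hσ, smul_mul_assoc,
    mul_smul_comm, smul_smul, Units.mul_inv, one_smul, mul_one] at hu'
  rw [← hu']
  calc _ = -((-1) * ((u : Matrix n n ℤ_[p])ᵀ * (J * c) * u)) := by noncomm_ring
    _ = _ := by rw [← hJ]; noncomm_ring

/-- A nonzero integral similitude intertwining `γ₀` and `γ` can be replaced by one whose multiplier
is a unit. -/
theorem exists_integral_conj {J γ₀ γ B : Matrix n n ℤ_[p]} {η : ℤ_[p]ˣ} {ν : ℤ_[p]}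
    (hsep : (γ₀.charpoly.map (PadicInt.toZMod (p := p))).Separable)
    (hJ : J * J = -1) (hJt : Jᵀ = -J)
    (hγ₀ : γ₀ᵀ * J * γ₀ = (η : ℤ_[p]) • J) (hγ : γᵀ * J * γ = (η : ℤ_[p]) • J)
    (hχ : γ.charpoly = γ₀.charpoly) (hBγ : γ₀ * B = B * γ) (hν : ν ≠ 0)
    (hB : Bᵀ * J * B = ν • J) :
    ∃ (k : Matrix n n ℤ_[p]) (w : ℤ_[p]ˣ), kᵀ * J * k = (w : ℤ_[p]) • J ∧ γ₀ * k = k * γ := by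
  have hsep' : (γ.charpoly.map (PadicInt.toZMod (p := p))).Separable := by rwa [hχ]
  obtain ⟨v, hv⟩ := exists_krylov_det_isUnit hsep'
  obtain ⟨v₀, hv₀⟩ := exists_krylov_det_isUnit hsep
  obtain ⟨K, hKdet, hK⟩ := exists_conj_of_charpoly_eq hv hv₀ hχ
  have hKunit : IsUnit K := (Matrix.isUnit_iff_isUnit_det K).2 hKdet
  have hJunit : IsUnit J := IsUnit.of_mul_eq_one_right (-J) (by simp [hJ])
  have hKb : K * (K⁻¹ * B) = B := Matrix.mul_nonsing_inv_cancel_left _ _ hKdet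
  have hJc : J * -(J * (Kᵀ * J * K)) = Kᵀ * J * K := by
    rw [mul_neg, ← mul_assoc, hJ]; simp
  have hform : γᵀ * (Kᵀ * J * K) * γ = (η : ℤ_[p]) • (Kᵀ * J * K) := by
    calc _ = (K * γ)ᵀ * J * (K * γ) := by rw [Matrix.transpose_mul]; noncomm_ring
      _ = Kᵀ * (γ₀ᵀ * J * γ₀) * K := by rw [← hK, Matrix.transpose_mul]; noncomm_ring
      _ = _ := by rw [hγ₀, mul_smul_comm, smul_mul_assoc]
  have hc : Commute γ (-(J * (Kᵀ * J * K))) := by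
    refine (isUnit_transpose_mul hJ hγ).mul_left_cancel ?_
    rw [← mul_assoc, hγ, smul_mul_assoc, hJc, ← mul_assoc, mul_assoc γᵀ, hJc, hform]
  have hb : Commute γ (K⁻¹ * B) := by
    refine hKunit.mul_left_cancel ?_
    rw [← mul_assoc, ← hK, mul_assoc, hKb, hBγ, ← mul_assoc, hKb]
  have hbform : (K⁻¹ * B)ᵀ * (J * -(J * (Kᵀ * J * K))) * (K⁻¹ * B) =
      ((PadicInt.unitCoeff hν : ℤ_[p]) * (p : ℤ_[p]) ^ ν.valuation) • J := by
    rw [← PadicInt.unitCoeff_spec hν, ← hB, hJc]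
    calc _ = (K * (K⁻¹ * B))ᵀ * J * (K * (K⁻¹ * B)) := by
          rw [Matrix.transpose_mul K]; noncomm_ring
      _ = _ := by rw [hKb]
  obtain ⟨u, hu, huJ⟩ := exists_commute_transpose_mul_eq hsep' hJ hJt hγ hc
    ((Matrix.isUnit_iff_isUnit_det _).1
      (hJunit.mul ((((Matrix.isUnit_transpose K).2 hKunit).mul hJunit).mul hKunit)).neg)
    (by rw [hJc, Matrix.transpose_mul, Matrix.transpose_mul, hJt, Matrix.transpose_transpose]
        noncomm_ring) hb hbform
  refine ⟨K * u, PadicInt.unitCoeff hν, ?_, ?_⟩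
  · rw [← huJ, hJc, Matrix.transpose_mul]
    noncomm_ring
  · rw [← mul_assoc, hK, mul_assoc, hu.eq, mul_assoc]

end padic

theorem Jmat_mul_self (R : Type*) [CommRing R] (g : ℕ) : Jmat R g * Jmat R g = -1 := by
  simp [Jmat, Matrix.fromBlocks_multiply, ← Matrix.fromBlocks_one, Matrix.fromBlocks_neg]

theorem Jmat_transpose (R : Type*) [CommRing R] (g : ℕ) : (Jmat R g)ᵀ = -Jmat R g := by
  simp [Jmat, Matrix.fromBlocks_transpose, Matrix.fromBlocks_neg]

theorem Jmat_map {R S : Type*} [CommRing R] [CommRing S] (φ : R →+* S) (g : ℕ) :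
    (Jmat R g).map φ = Jmat S g := by
  ext (i | i) (j | j) <;> simp [Jmat, Matrix.one_apply, apply_ite φ]

theorem smul_Jmat_injective {R : Type*} [CommRing R] {g : ℕ} (hg : 1 ≤ g) {a b : R}
    (h : a • Jmat R g = b • Jmat R g) : a = b := by
  simpa [Jmat] using congrFun (congrFun h (Sum.inr ⟨0, hg⟩)) (Sum.inl ⟨0, hg⟩)

theorem exists_integral_multiple {p : ℕ} [Fact p.Prime] {n : Type*} [Finite n]
    (h : Matrix n n ℚ_[p]) : ∃ (d : ℤ_[p]) (B : Matrix n n ℤ_[p]), d ≠ 0 ∧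
      B.map PadicInt.Coe.ringHom = (d : ℚ_[p]) • h := by
  obtain ⟨d, hd⟩ := IsLocalization.exist_integer_multiples_of_finite
    (nonZeroDivisors ℤ_[p]) (fun ij : n × n => h ij.1 ij.2)
  choose B hB using hd
  refine ⟨d, Matrix.of fun i j => B (i, j), nonZeroDivisors.ne_zero d.2, ?_⟩
  ext i j
  exact (hB (i, j)).trans (Algebra.smul_def _ _)

/-- Lemma 3.1 of the paper.  If `γ₀ ∈ GSp_{2g}(ℤ_p)` has
characteristic polynomial whose reduction mod `p` is separable, then for
`γ ∈ GSp_{2g}(ℤ_p)`, conjugacy over `ℚ_p` is equivalent to conjugacy over `ℤ_p`. -/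
theorem statement0 (p : ℕ) [Fact p.Prime] (g : ℕ) (hg : 1 ≤ g)
    (γ₀ γ : Matrix (Fin g ⊕ Fin g) (Fin g ⊕ Fin g) ℤ_[p])
    (hγ₀ : γ₀ ∈ GSpZp p g) (hγ : γ ∈ GSpZp p g)
    (hsep : ((γ₀.charpoly).map (PadicInt.toZMod (p := p))).Separable) :
    (∃ h ∈ GSpQp p g, h⁻¹ * matQp p g γ₀ * h = matQp p g γ) ↔
      (∃ k ∈ GSpZp p g, k⁻¹ * γ₀ * k = γ) := by
  let Φ : Matrix (Fin g ⊕ Fin g) (Fin g ⊕ Fin g) ℤ_[p] →+* Matrix _ _ ℚ_[p] :=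
    (PadicInt.Coe.ringHom (p := p)).mapMatrix
  have hΦ : Function.Injective Φ := Matrix.map_injective Subtype.val_injective
  have hΦJ : Φ (Jmat ℤ_[p] g) = Jmat ℚ_[p] g := Jmat_map _ g
  have hΦt (A) : Φ Aᵀ = (Φ A)ᵀ := rfl
  have hΦs (a : ℤ_[p]) (A) : Φ (a • A) = (a : ℚ_[p]) • Φ A :=
    Matrix.ext fun _ _ => PadicInt.coe_mul _ _
  have hΦm (A) : matQp p g A = Φ A := rfl
  have hJ := Jmat_mul_self ℤ_[p] g
  simp only [hΦm]
  constructor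
  · rintro ⟨h, ⟨hdet, μ, hμ, hh⟩, hconj⟩
    obtain ⟨η₀, hη₀⟩ := hγ₀
    obtain ⟨η, hη⟩ := hγ
    have hint : Φ γ₀ * h = h * Φ γ := by
      rw [← hconj, mul_assoc, Matrix.mul_nonsing_inv_cancel_left _ _ hdet]
    have hχ : γ.charpoly = γ₀.charpoly := by
      refine Polynomial.map_injective (PadicInt.Coe.ringHom (p := p)) Subtype.val_injective ?_
      rw [← Matrix.charpoly_map, ← Matrix.charpoly_map]
      change (Φ γ).charpoly = (Φ γ₀).charpoly
      rw [← hconj, mul_assoc, Matrix.charpoly_mul_comm,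
        Matrix.mul_nonsing_inv_cancel_right _ _ hdet]
    obtain ⟨d, B, hd, hB⟩ := exists_integral_multiple h
    replace hB : Φ B = (d : ℚ_[p]) • h := hB
    have hBγ : γ₀ * B = B * γ := by
      apply hΦ
      rw [map_mul, map_mul, hB, mul_smul_comm, hint, smul_mul_assoc]
    have hBJ : Φ (Bᵀ * Jmat ℤ_[p] g * B) = ((d : ℚ_[p]) * d * μ) • Jmat ℚ_[p] g := by
      rw [map_mul, map_mul, hΦt, hΦJ, hB, Matrix.transpose_smul, smul_mul_assoc, smul_mul_assoc,
        mul_smul_comm, hh, smul_smul, smul_smul]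
    obtain ⟨ν, hν⟩ : ∃ ν : ℤ_[p], (ν : ℚ_[p]) = (d : ℚ_[p]) * d * μ :=
      ⟨(Bᵀ * Jmat ℤ_[p] g * B) (Sum.inr ⟨0, hg⟩) (Sum.inl ⟨0, hg⟩),
        (congrFun (congrFun hBJ (Sum.inr ⟨0, hg⟩)) (Sum.inl ⟨0, hg⟩)).trans (by simp [Jmat])⟩
    have hν0 : ν ≠ 0 := by
      rintro rfl
      simp [hd, hμ] at hν
    have hBJ' : Bᵀ * Jmat ℤ_[p] g * B = ν • Jmat ℤ_[p] g :=
      hΦ (by rw [hBJ, hΦs, hΦJ, hν])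
    have hηη : (η : ℤ_[p]) = η₀ := by
      refine mul_left_cancel₀ hν0 (smul_Jmat_injective hg ?_)
      calc (ν * (η : ℤ_[p])) • Jmat ℤ_[p] g
          = γᵀ * (Bᵀ * Jmat ℤ_[p] g * B) * γ := by
            rw [hBJ', mul_smul_comm, smul_mul_assoc, hη, smul_smul]
        _ = (B * γ)ᵀ * Jmat ℤ_[p] g * (B * γ) := by rw [Matrix.transpose_mul]; noncomm_ring
        _ = Bᵀ * (γ₀ᵀ * Jmat ℤ_[p] g * γ₀) * B := by
            rw [← hBγ, Matrix.transpose_mul]; noncomm_ring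
        _ = (ν * (η₀ : ℤ_[p])) • Jmat ℤ_[p] g := by
            rw [hη₀, mul_smul_comm, smul_mul_assoc, hBJ', smul_smul, mul_comm]
    obtain ⟨k, w, hk, hkγ⟩ := exists_integral_conj hsep hJ (Jmat_transpose _ g)
      (hηη ▸ hη₀) hη hχ hBγ hν0 hBJ'
    have hkdet := (Matrix.isUnit_iff_isUnit_det k).1 (isUnit_of_transpose_mul_mul_eq hJ hk)
    exact ⟨k, ⟨w, hk⟩, by rw [mul_assoc, hkγ, Matrix.nonsing_inv_mul_cancel_left _ _ hkdet]⟩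
  · rintro ⟨k, ⟨w, hk⟩, hconj⟩
    have hkdet := (Matrix.isUnit_iff_isUnit_det k).1 (isUnit_of_transpose_mul_mul_eq hJ hk)
    have hkΦ : IsUnit (Φ k).det :=
      (Matrix.isUnit_iff_isUnit_det _).1 ((isUnit_of_transpose_mul_mul_eq hJ hk).map Φ)
    refine ⟨Φ k, ⟨hkΦ, (w : ℤ_[p]), ?_, ?_⟩, ?_⟩
    · simp
    · rw [← hΦJ, ← hΦt, ← map_mul, ← map_mul, hk, hΦs]
    · have hkγ : γ₀ * k = k * γ := by
        rw [← hconj, mul_assoc, Matrix.mul_nonsing_inv_cancel_left _ _ hkdet]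
      rw [mul_assoc, ← map_mul, hkγ, map_mul, Matrix.nonsing_inv_mul_cancel_left _ _ hkΦ]
end

section
/- Let p be a prime, e ≥ 1, and g ≥ 1. Let γ ∈ Mat_{2g}(ℤ_p) satisfy γᵀ·J·γ = η·J for some η ∈ ℤ_p with p-adic valuation v_p(η) = e. Assume either (i) e = 1, or (ii) the reduction modulo p of the characteristic polynomial of γ equals T^g·h(T) for a polynomial h over ℤ/pℤ with h(0) ≠ 0 (the ordinary condition: exactly g of the eigenvalues of γ are p-adic units). Then there exist k₁, k₂ ∈ GSp_{2g}(ℤ_p) such that γ = k₁·D·k₂, where D is the diagonal matrix with g entries equal to p^e followed by g entries equal to 1. -/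
open Matrix

variable (p : ℕ) [Fact p.Prime] (g : ℕ)

section Field

variable {F : Type*} [Field F] {n : Type*} [Fintype n] [DecidableEq n]

theorem exists_isSymm_isUnit_add_mul_diagonal
    {d : n → F} {Y : Matrix n n F} (hsymm : (diagonal d * Y).IsSymm)
    (hker : ∀ v, diagonal d *ᵥ v = 0 → Y *ᵥ v = 0 → v = 0) :
    ∃ S : Matrix n n F, S.IsSymm ∧ IsUnit (Y + S * diagonal d) := by
  have hY (i j) : d i * Y i j = d j * Y j i := by
    simpa using hsymm.apply j i
  let S : Matrix n n F := Matrix.of fun i j => d i * (d i)⁻¹ * (1 - Y) i j * (d j)⁻¹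
  have hrow (i j) (hi : d i ≠ 0) : (Y + S * diagonal d) i j = (1 : Matrix n n F) i j := by
    by_cases hj : d j = 0
    · have hij : i ≠ j := fun h => hi (h ▸ hj)
      have := hY i j
      simp_all [S]
    · simp [S, hi, hj]
  refine ⟨S, Matrix.IsSymm.ext fun i j => ?_, mulVec_injective_iff_isUnit.1 ?_⟩
  · by_cases hi : d i = 0
    · simp [S, hi]
    by_cases hj : d j = 0
    · simp [S, hj]
    by_cases hij : i = j
    · rw [hij]
    · have := hY i j
      simp only [S, of_apply, Matrix.sub_apply, one_apply_ne hij, one_apply_ne (Ne.symm hij)]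
      field_simp
      linear_combination this
  · rw [← coe_mulVecLin, ← LinearMap.ker_eq_bot, ker_mulVecLin_eq_bot_iff]
    intro v hv
    have hv₁ : diagonal d *ᵥ v = 0 := by
      ext i
      rw [mulVec_diagonal, Pi.zero_apply]
      by_cases hi : d i = 0
      · simp [hi]
      · have := congrFun hv i
        simp only [mulVec, dotProduct, hrow i _ hi] at this
        simp [one_apply] at this
        simp [this]
    refine hker v hv₁ ?_
    rw [add_mulVec, ← mulVec_mulVec, hv₁, mulVec_zero, add_zero] at hv
    exact hv

/-- If `Xᵀ * Y` is symmetric and `X`, `Y` have no common kernel, then `Y + S * X` is invertible for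
some symmetric `S`. -/
theorem exists_isSymm_isUnit_add_mul {X Y : Matrix n n F} (hsymm : (Xᵀ * Y).IsSymm)
    (hker : ∀ v, X *ᵥ v = 0 → Y *ᵥ v = 0 → v = 0) :
    ∃ S : Matrix n n F, S.IsSymm ∧ IsUnit (Y + S * X) := by
  obtain ⟨L, L', d, hX⟩ := Pivot.exists_list_transvec_mul_diagonal_mul_list_transvec X
  set P := (L.map TransvectionStruct.toMatrix).prod
  set Q := (L'.map TransvectionStruct.toMatrix).prod
  have hP : IsUnit P.det := by simp [P]
  have hQ : IsUnit Q.det := by simp [Q]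
  have hQt : IsUnit Qᵀ.det := by rwa [det_transpose]
  have hPt : IsUnit Pᵀ.det := by rwa [det_transpose]
  have hPY : diagonal d * (Pᵀ * Y * Q⁻¹) = Qᵀ⁻¹ * (Xᵀ * Y) * Q⁻¹ := by
    rw [hX]
    simp only [transpose_mul, diagonal_transpose, ← mul_assoc, nonsing_inv_mul _ hQt, one_mul]
  obtain ⟨S, hS, hu⟩ := exists_isSymm_isUnit_add_mul_diagonal (d := d) (Y := Pᵀ * Y * Q⁻¹)
    (by
      rw [hPY, Matrix.IsSymm, transpose_mul, transpose_mul, hsymm.eq, ← transpose_nonsing_inv,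
        transpose_transpose, Matrix.mul_assoc Q⁻¹ᵀ])
    (by
      intro v h₁ h₂
      have key : Q⁻¹ *ᵥ v = 0 := by
        refine hker _ ?_ ?_
        · rw [hX, mulVec_mulVec, mul_assoc, mul_nonsing_inv _ hQ, mul_one, ← mulVec_mulVec, h₁,
            mulVec_zero]
        · have := congrArg (fun w => Pᵀ⁻¹ *ᵥ w) h₂
          simpa [mulVec_mulVec, ← mul_assoc, nonsing_inv_mul _ hPt] using this
      simpa [mulVec_mulVec, mul_nonsing_inv _ hQ] using congrArg (fun w => Q *ᵥ w) key)
  refine ⟨Pᵀ⁻¹ * S * P⁻¹, ?_, ?_⟩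
  · rw [Matrix.IsSymm, transpose_mul, transpose_mul, hS.eq, ← transpose_nonsing_inv,
      transpose_transpose, mul_assoc]
  · have : Y + Pᵀ⁻¹ * S * P⁻¹ * X = Pᵀ⁻¹ * (Pᵀ * Y * Q⁻¹ + S * diagonal d) * Q := by
      rw [hX]
      simp only [mul_add, add_mul, ← mul_assoc, nonsing_inv_mul _ hPt, one_mul]
      simp only [mul_assoc, nonsing_inv_mul _ hQ, nonsing_inv_mul_cancel_left _ _ hP, mul_one]
    rw [this]
    exact ((isUnit_nonsing_inv_iff.2 ((isUnit_iff_isUnit_det _).2 hPt)).mul hu).mul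
      ((isUnit_iff_isUnit_det _).2 hQ)

theorem exists_rank_factorization {r : ℕ} (A : Matrix n n F) (hA : A.rank = r) :
    ∃ (M : Matrix n (Fin r) F) (M' : Matrix (Fin r) n F) (N : Matrix (Fin r) n F)
      (N' : Matrix n (Fin r) F), M * N = A ∧ M' * M = 1 ∧ N * N' = 1 := by
  subst hA
  obtain ⟨V, U, e, hV, hU, h⟩ := exists_rank_normal_form A
  rw [isUnit_iff_isUnit_det] at hV hU
  let R : Matrix n (Fin A.rank) F := (fromRows 1 0).submatrix e id
  let C : Matrix (Fin A.rank) n F := (fromCols 1 0).submatrix id e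
  have hRC : R * C = (fromBlocks 1 0 0 0).submatrix e e := by
    rw [← submatrix_mul _ _ _ _ _ Function.bijective_id, fromRows_mul_fromCols]
    simp
  have hCR : C * R = 1 := by
    rw [← submatrix_mul _ _ _ _ _ e.bijective, fromCols_mul_fromRows]
    simp
  refine ⟨V⁻¹ * R, C * V, C * U⁻¹, U * R, ?_, ?_, ?_⟩
  · have h' : V⁻¹ * (V * A * U) * U⁻¹ = A := by
      rw [Matrix.mul_assoc V, nonsing_inv_mul_cancel_left _ _ hV, mul_nonsing_inv_cancel_right _ _ hU]
    rw [← Matrix.mul_assoc, Matrix.mul_assoc _ R C, hRC, ← h, h']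
  · rw [Matrix.mul_assoc, mul_nonsing_inv_cancel_left _ _ hV, hCR]
  · rw [Matrix.mul_assoc, nonsing_inv_mul_cancel_left _ _ hU, hCR]

theorem exists_isSymm_isUnit_toBlocks₂₂ {g : ℕ}
    (B : Matrix (Fin g ⊕ Fin g) (Fin g ⊕ Fin g) F) (hr : B.rank = g)
    (h₁ : Bᵀ * Jmat F g * B = 0) (h₂ : B * Jmat F g * Bᵀ = 0) :
    ∃ S T : Matrix (Fin g) (Fin g) F, S.IsSymm ∧ T.IsSymm ∧
      IsUnit (fromBlocks 1 0 S 1 * B * fromBlocks 1 T 0 1).toBlocks₂₂ := by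
  obtain ⟨M, M', N, N', hB, hM, hN⟩ := exists_rank_factorization B hr
  have hMt : Mᵀ * M'ᵀ = 1 := by rw [← transpose_mul, hM, transpose_one]
  have hNt : N'ᵀ * Nᵀ = 1 := by rw [← transpose_mul, hN, transpose_one]
  have hMJ : Mᵀ * Jmat F g * M = 0 := by
    have := congrArg (fun Z => N'ᵀ * Z * N') h₁
    simpa only [← hB, transpose_mul, Matrix.mul_assoc, hN, Matrix.mul_one,
      ← Matrix.mul_assoc N'ᵀ, hNt, Matrix.one_mul, Matrix.mul_zero, Matrix.zero_mul] using this
  have hNJ : N * Jmat F g * Nᵀ = 0 := by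
    have := congrArg (fun Z => M' * Z * M'ᵀ) h₂
    simpa only [← hB, transpose_mul, Matrix.mul_assoc, hMt, Matrix.mul_one,
      ← Matrix.mul_assoc M', hM, Matrix.one_mul, Matrix.mul_zero, Matrix.zero_mul] using this
  obtain ⟨X, Y, rfl⟩ : ∃ X Y, M = fromRows X Y := ⟨_, _, (fromRows_toRows M).symm⟩
  obtain ⟨C, E, rfl⟩ : ∃ C E, N = fromCols C E := ⟨_, _, (fromCols_toCols N).symm⟩
  obtain ⟨S, hS, hSu⟩ := exists_isSymm_isUnit_add_mul (X := X) (Y := Y)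
    (by
      rw [Jmat, transpose_fromRows, fromCols_mul_fromBlocks, fromCols_mul_fromRows] at hMJ
      simp only [mul_zero, mul_one, mul_neg, zero_add, add_zero, neg_mul] at hMJ
      rw [Matrix.IsSymm, transpose_mul, transpose_transpose]
      exact add_neg_eq_zero.1 hMJ)
    (by
      intro v hX hY
      have : M' *ᵥ (fromRows X Y *ᵥ v) = v := by rw [mulVec_mulVec, hM, one_mulVec]
      rw [← this, fromRows_mulVec, hX, hY]
      simp)
  obtain ⟨T, hT, hTu⟩ := exists_isSymm_isUnit_add_mul (X := Cᵀ) (Y := Eᵀ)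
    (by
      rw [Jmat, transpose_fromCols, fromCols_mul_fromBlocks, fromCols_mul_fromRows] at hNJ
      simp only [mul_zero, mul_one, mul_neg, zero_add, add_zero, neg_mul] at hNJ
      rw [Matrix.IsSymm, transpose_mul, transpose_transpose, transpose_transpose]
      exact add_neg_eq_zero.1 hNJ)
    (by
      intro v hX hY
      have : N'ᵀ *ᵥ ((fromCols C E)ᵀ *ᵥ v) = v := by rw [mulVec_mulVec, hNt, one_mulVec]
      rw [← this, transpose_fromCols, fromRows_mulVec, hX, hY]
      simp)
  refine ⟨S, T, hS, hT, ?_⟩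
  have hTu' : IsUnit (C * T + E) := by
    rw [← isUnit_transpose, transpose_add, transpose_mul, hT.eq, add_comm]
    exact hTu
  rw [← hB, ← Matrix.mul_assoc, fromBlocks_mul_fromRows, Matrix.mul_assoc, fromCols_mul_fromBlocks,
    fromRows_mul_fromCols, toBlocks_fromBlocks₂₂]
  simp only [one_mul, mul_one]
  rw [add_comm] at hSu
  exact hSu.mul hTu'

end Field

section Rank

variable {F : Type*} [Field F] {g : ℕ}

theorem Jmat_mul_Jmat {R : Type*} [CommRing R] : Jmat R g * Jmat R g = -1 :=
  J_squared (Fin g) R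

theorem rank_le_of_transpose_mul_Jmat_mul_eq_zero
    {B : Matrix (Fin g ⊕ Fin g) (Fin g ⊕ Fin g) F} (h : Bᵀ * Jmat F g * B = 0) : B.rank ≤ g := by
  have hle := rank_add_rank_le_card_of_mul_eq_zero h
  have hJ : IsUnit (Jmat F g).det := isUnit_det_J (Fin g) F
  rw [rank_mul_eq_left_of_isUnit_det _ _ hJ, rank_transpose] at hle
  simp only [Fintype.card_sum, Fintype.card_fin] at hle
  omega

theorem rank_add_finrank_ker (B : Matrix (Fin g ⊕ Fin g) (Fin g ⊕ Fin g) F) :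
    B.rank + Module.finrank F B.mulVecLin.ker = g + g := by
  simpa [rank] using B.mulVecLin.finrank_range_add_finrank_ker

theorem le_rank_of_charpoly_eq_X_pow_mul
    {B : Matrix (Fin g ⊕ Fin g) (Fin g ⊕ Fin g) F} {h : Polynomial F}
    (hB : B.charpoly = Polynomial.X ^ g * h) (h0 : h.eval 0 ≠ 0) : g ≤ B.rank := by
  have hker : Module.finrank F B.mulVecLin.ker ≤ g := by
    have hdeg : (B.toLin').charpoly.natTrailingDegree = g := by
      have hh : h ≠ 0 := by rintro rfl; simp at h0
      rw [charpoly_toLin', hB, mul_comm, Polynomial.natTrailingDegree_mul_X_pow hh,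
        Polynomial.natTrailingDegree_eq_zero.2 (Or.inr (by rwa [Polynomial.coeff_zero_eq_eval_zero])),
        zero_add]
    refine le_trans (Submodule.finrank_mono ?_)
      ((LinearMap.finrank_maxGenEigenspace_zero_eq _).trans hdeg).le
    rw [← toLin'_apply']
    rw [← Module.End.eigenspace_zero]
    exact Module.End.genEigenspace_le_maximal _ _ _
  have := rank_add_finrank_ker B
  omega

end Rank

section Similitude

variable {R : Type*} [CommRing R] {g : ℕ}

theorem mul_eq_smul_one_comm [IsDomain R] {n : Type*} [Fintype n] [DecidableEq n]
    {A B : Matrix n n R} {c : R} (hc : c ≠ 0) (h : A * B = c • 1) : B * A = c • 1 := by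
  have hdet : B.det ≠ 0 := by
    intro h0
    have := congrArg det h
    rw [det_mul, h0, mul_zero, det_smul, det_one, mul_one] at this
    exact pow_ne_zero _ hc this.symm
  have hz : (B * A - c • 1) * B = 0 := by
    rw [sub_mul, mul_assoc, h]; simp
  have := congrArg (· * B.adjugate) hz
  simp only [mul_assoc, mul_adjugate, zero_mul, mul_smul_comm, mul_one] at this
  exact sub_eq_zero.1 ((smul_eq_zero.1 this).resolve_left hdet)

theorem adjoint_mul {A : Matrix (Fin g ⊕ Fin g) (Fin g ⊕ Fin g) R} {c : R}
    (h : Aᵀ * Jmat R g * A = c • Jmat R g) :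
    -(Jmat R g * Aᵀ * Jmat R g) * A = c • 1 := by
  rw [neg_mul, mul_assoc _ _ A, mul_assoc _ Aᵀ, ← mul_assoc Aᵀ, h, mul_smul_comm, Jmat_mul_Jmat]
  simp

theorem mul_Jmat_mul_transpose [IsDomain R]
    {A : Matrix (Fin g ⊕ Fin g) (Fin g ⊕ Fin g) R} {c : R} (hc : c ≠ 0)
    (h : Aᵀ * Jmat R g * A = c • Jmat R g) : A * Jmat R g * Aᵀ = c • Jmat R g := by
  have := congrArg (· * Jmat R g) (mul_eq_smul_one_comm hc (adjoint_mul h))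
  simpa [mul_assoc, Jmat_mul_Jmat] using this

theorem similitude_mul {A B : Matrix (Fin g ⊕ Fin g) (Fin g ⊕ Fin g) R} {a b : R}
    (hA : Aᵀ * Jmat R g * A = a • Jmat R g) (hB : Bᵀ * Jmat R g * B = b • Jmat R g) :
    (A * B)ᵀ * Jmat R g * (A * B) = (a * b) • Jmat R g := by
  rw [transpose_mul, mul_assoc, mul_assoc, ← mul_assoc _ A, ← mul_assoc Aᵀ, ← mul_assoc Aᵀ, hA,
    smul_mul_assoc, mul_smul_comm, ← mul_assoc, hB, smul_smul]

theorem similitude_lower {S : Matrix (Fin g) (Fin g) R} (hS : S.IsSymm) :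
    (fromBlocks 1 0 S 1)ᵀ * Jmat R g * fromBlocks 1 0 S 1 = (1 : R) • Jmat R g := by
  simp [Jmat, fromBlocks_transpose, fromBlocks_multiply, hS.eq]

theorem similitude_upper {S : Matrix (Fin g) (Fin g) R} (hS : S.IsSymm) :
    (fromBlocks 1 S 0 1)ᵀ * Jmat R g * fromBlocks 1 S 0 1 = (1 : R) • Jmat R g := by
  simp [Jmat, fromBlocks_transpose, fromBlocks_multiply, hS.eq]

/-- A similitude with invertible lower right block is a product of unipotent and block diagonal
similitudes. -/
theorem similitude_decomposition [IsDomain R] {A B C E : Matrix (Fin g) (Fin g) R} {c : R}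
    (hc : c ≠ 0) (hE : IsUnit E.det)
    (h : (fromBlocks A B C E)ᵀ * Jmat R g * fromBlocks A B C E = c • Jmat R g) :
    ∃ S T : Matrix (Fin g) (Fin g) R, S.IsSymm ∧ T.IsSymm ∧
      fromBlocks A B C E =
        fromBlocks 1 S 0 1 * fromBlocks Eᵀ⁻¹ 0 0 E * fromBlocks (c • 1) 0 0 1 *
          fromBlocks 1 0 T 1 := by
  have hEt : IsUnit Eᵀ.det := by rwa [det_transpose]
  have hEJ := mul_Jmat_mul_transpose hc h
  simp only [Jmat, fromBlocks_transpose, fromBlocks_multiply, fromBlocks_smul, mul_zero, mul_one,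
    mul_neg, zero_add, add_zero, neg_mul, smul_zero, smul_neg, fromBlocks_inj] at h hEJ
  obtain ⟨-, -, h₁, h₂⟩ := h
  obtain ⟨-, -, -, h₃⟩ := hEJ
  have hBE : Bᵀ * E = Eᵀ * B := (add_neg_eq_zero.1 h₂).symm
  have hCE : E * Cᵀ = C * Eᵀ := add_neg_eq_zero.1 h₃
  have hS : B * E⁻¹ = Eᵀ⁻¹ * Bᵀ := by
    have := congrArg (fun Z => Eᵀ⁻¹ * Z * E⁻¹) hBE
    simp only [mul_assoc, mul_nonsing_inv _ hE, nonsing_inv_mul_cancel_left _ _ hEt, mul_one] at this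
    exact this.symm
  have hT : E⁻¹ * C = Cᵀ * Eᵀ⁻¹ := by
    have := congrArg (fun Z => E⁻¹ * Z * Eᵀ⁻¹) hCE
    simp only [mul_assoc, mul_nonsing_inv _ hEt, nonsing_inv_mul_cancel_left _ _ hE, mul_one] at this
    exact this.symm
  refine ⟨B * E⁻¹, E⁻¹ * C, ?_, ?_, ?_⟩
  · rw [Matrix.IsSymm, transpose_mul, transpose_nonsing_inv, hS]
  · rw [Matrix.IsSymm, transpose_mul, transpose_nonsing_inv, hT]
  · have hA : A = c • Eᵀ⁻¹ + Eᵀ⁻¹ * Bᵀ * C := by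
      have h₁' : Eᵀ * A = c • 1 + Bᵀ * C := by
        rw [← h₁, neg_add_cancel_right]
      have := congrArg (Eᵀ⁻¹ * ·) h₁'
      simpa [nonsing_inv_mul_cancel_left _ _ hEt, mul_add, mul_assoc] using this
    simp only [fromBlocks_multiply, mul_zero, mul_one, zero_add, add_zero, zero_mul, one_mul,
      nonsing_inv_mul_cancel_right _ _ hE, mul_nonsing_inv_cancel_left _ _ hE, ← mul_assoc,
      mul_smul_comm, smul_zero]
    rw [← hS] at hA
    rw [← hA]

end Similitude

section Padic

variable {p : ℕ} [Fact p.Prime] {g : ℕ}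

theorem toZMod_eq_zero_iff_dvd {x : ℤ_[p]} :
    PadicInt.toZMod x = 0 ↔ (p : ℤ_[p]) ∣ x := by
  rw [← RingHom.mem_ker, PadicInt.ker_toZMod, PadicInt.maximalIdeal_eq_span_p,
    Ideal.mem_span_singleton]

theorem isUnit_iff_toZMod_ne_zero {x : ℤ_[p]} :
    IsUnit x ↔ PadicInt.toZMod x ≠ 0 := by
  rw [Ne, ← RingHom.mem_ker, PadicInt.ker_toZMod, IsLocalRing.mem_maximalIdeal, mem_nonunits_iff,
    not_not]

theorem map_similitude {γ : Matrix (Fin g ⊕ Fin g) (Fin g ⊕ Fin g) ℤ_[p]} {η : ℤ_[p]}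
    (hp : (p : ℤ_[p]) ∣ η) (h : γᵀ * Jmat ℤ_[p] g * γ = η • Jmat ℤ_[p] g) :
    (γ.map (PadicInt.toZMod (p := p)))ᵀ * Jmat (ZMod p) g * γ.map (PadicInt.toZMod (p := p)) = 0 := by
  have := congrArg (PadicInt.toZMod (p := p)).mapMatrix h
  have hJ : (Jmat ℤ_[p] g).map (PadicInt.toZMod (p := p)) = Jmat (ZMod p) g := by
    simp [Jmat, fromBlocks_map, Matrix.map_neg]
  simp only [map_mul, RingHom.mapMatrix_apply, hJ] at this
  rw [← transpose_map, this]
  ext i j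
  simp [toZMod_eq_zero_iff_dvd.2 hp]

/-- If the multiplier is exactly divisible by `p`, then the kernel of the reduction of `γ` lies in
the range of the reduction of its symplectic adjoint. -/
theorem le_rank_of_valuation_eq_one
    {γ : Matrix (Fin g ⊕ Fin g) (Fin g ⊕ Fin g) ℤ_[p]} {u : ℤ_[p]ˣ}
    (h : γᵀ * Jmat ℤ_[p] g * γ = ((u : ℤ_[p]) * p) • Jmat ℤ_[p] g) :
    g ≤ (γ.map (PadicInt.toZMod (p := p))).rank := by
  set φ := PadicInt.toZMod (p := p)
  set γ' := -(Jmat ℤ_[p] g * γᵀ * Jmat ℤ_[p] g)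
  have hγ' : γ' * γ = ((u : ℤ_[p]) * p) • 1 := adjoint_mul h
  have hle : (γ.map φ).mulVecLin.ker ≤ (γ'.map φ).mulVecLin.range := by
    intro v hv
    obtain ⟨s, hs⟩ := (ZMod.ringHom_surjective φ).hasRightInverse
    have hv' : γ.map φ *ᵥ v = 0 := hv
    have hvs : φ ∘ (s ∘ v) = v := funext fun i => hs _
    have hdvd (i) : (p : ℤ_[p]) ∣ (γ *ᵥ (s ∘ v)) i := by
      rw [← toZMod_eq_zero_iff_dvd]
      have := RingHom.map_mulVec φ γ (s ∘ v) i
      rw [hvs, hv'] at this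
      exact this
    choose w hw using hdvd
    have hpw : (p : ℤ_[p]) • w = γ *ᵥ (s ∘ v) := funext fun i => (hw i).symm
    have huw : γ' *ᵥ w = (u : ℤ_[p]) • (s ∘ v) := by
      have hp0 : (p : ℤ_[p]) ≠ 0 := Nat.cast_ne_zero.2 (Fact.out : p.Prime).ne_zero
      refine smul_right_injective _ hp0 ?_
      simp only
      rw [← mulVec_smul, hpw, mulVec_mulVec, hγ', smul_mulVec, one_mulVec, smul_smul, mul_comm]
    refine ⟨φ ∘ ((↑u⁻¹ : ℤ_[p]) • w), ?_⟩
    rw [mulVecLin_apply]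
    ext i
    rw [← RingHom.map_mulVec, mulVec_smul, huw, smul_smul, Units.inv_mul, one_smul]
    exact hs _
  have hrank : (γ'.map φ).rank ≤ (γ.map φ).rank := by
    have : γ'.map φ = -((Jmat ℤ_[p] g).map φ) * (γ.map φ)ᵀ * (Jmat ℤ_[p] g).map φ := by
      simp only [γ', ← RingHom.mapMatrix_apply, map_neg, map_mul, neg_mul]
      rfl
    rw [this]
    refine (rank_mul_le_left _ _).trans ((rank_mul_le_right _ _).trans ?_)
    rw [rank_transpose]
  have hker := Submodule.finrank_mono hle
  have := rank_add_finrank_ker (γ.map φ)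
  change _ ≤ (γ'.map φ).rank at hker
  omega

theorem exists_isSymm_map_toZMod_eq {n : Type*} {B : Matrix n n (ZMod p)}
    (hB : B.IsSymm) :
    ∃ A : Matrix n n ℤ_[p], A.IsSymm ∧ A.map (PadicInt.toZMod (p := p)) = B := by
  obtain ⟨s, hs⟩ := (ZMod.ringHom_surjective (PadicInt.toZMod (p := p))).hasRightInverse
  exact ⟨B.map s, hB.map s, Matrix.ext fun i j => hs _⟩

theorem mul_mem_GSpZp {A B : Matrix (Fin g ⊕ Fin g) (Fin g ⊕ Fin g) ℤ_[p]}
    (hA : A ∈ GSpZp p g) (hB : B ∈ GSpZp p g) : A * B ∈ GSpZp p g := by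
  obtain ⟨a, ha⟩ := hA
  obtain ⟨b, hb⟩ := hB
  exact ⟨a * b, by rw [similitude_mul ha hb, Units.val_mul]⟩

theorem fromBlocks_lower_mem_GSpZp {S : Matrix (Fin g) (Fin g) ℤ_[p]} (hS : S.IsSymm) :
    fromBlocks 1 0 S 1 ∈ GSpZp p g := ⟨1, similitude_lower hS⟩

theorem fromBlocks_upper_mem_GSpZp {S : Matrix (Fin g) (Fin g) ℤ_[p]} (hS : S.IsSymm) :
    fromBlocks 1 S 0 1 ∈ GSpZp p g := ⟨1, similitude_upper hS⟩

theorem fromBlocks_diagonal_mem_GSpZp {E : Matrix (Fin g) (Fin g) ℤ_[p]}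
    (hE : IsUnit E.det) (u : ℤ_[p]ˣ) :
    fromBlocks ((u : ℤ_[p]) • Eᵀ⁻¹) 0 0 E ∈ GSpZp p g := by
  have hEt : IsUnit Eᵀ.det := by rwa [det_transpose]
  refine ⟨u, ?_⟩
  simp [Jmat, fromBlocks_transpose, fromBlocks_multiply, fromBlocks_smul, transpose_nonsing_inv,
    nonsing_inv_mul _ hE, mul_nonsing_inv _ hEt]

end Padic

/-- Lemma 4.7, `lem:ordcartan`, of the paper: an integral
symplectic similitude whose multiplier has valuation `e`, which is either
ordinary or has `e = 1`, lies in the double coset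
`GSp_{2g}(ℤ_p)·diag(pᵉ,…,pᵉ,1,…,1)·GSp_{2g}(ℤ_p)`. -/
theorem statement8 (p : ℕ) [Fact p.Prime] (e g : ℕ) (he : 1 ≤ e) (hg : 1 ≤ g)
    (γ : Matrix (Fin g ⊕ Fin g) (Fin g ⊕ Fin g) ℤ_[p]) (η : ℤ_[p])
    (hγ : γᵀ * Jmat ℤ_[p] g * γ = η • Jmat ℤ_[p] g)
    (hval : η.valuation = (e : ℤ))
    (hcase : e = 1 ∨ ∃ h : Polynomial (ZMod p),
        (γ.charpoly).map (PadicInt.toZMod (p := p)) = Polynomial.X ^ g * h ∧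
          h.eval 0 ≠ 0) :
    ∃ k₁ ∈ GSpZp p g, ∃ k₂ ∈ GSpZp p g,
      γ = k₁ *
        Matrix.fromBlocks (Matrix.diagonal fun _ => (p : ℤ_[p]) ^ e) 0 0 1 * k₂ := by
  have hη0 : η ≠ 0 := by
    rintro rfl
    simp at hval
    omega
  obtain ⟨u, hu⟩ : ∃ u : ℤ_[p]ˣ, η = u * (p : ℤ_[p]) ^ e := by
    have hv : η.valuation = e := by exact_mod_cast hval
    exact ⟨PadicInt.unitCoeff hη0, by rw [← hv]; exact PadicInt.unitCoeff_spec hη0⟩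
  have hpη : (p : ℤ_[p]) ∣ η :=
    hu ▸ Dvd.dvd.mul_left (dvd_pow_self _ (by omega)) _
  set φ := PadicInt.toZMod (p := p)
  have hB₁ := map_similitude hpη hγ
  have hB₂ := map_similitude (γ := γᵀ) hpη
    (by rw [transpose_transpose]; exact mul_Jmat_mul_transpose hη0 hγ)
  rw [← transpose_map, transpose_transpose] at hB₂
  have hrank : (γ.map φ).rank = g := by
    refine le_antisymm (rank_le_of_transpose_mul_Jmat_mul_eq_zero hB₁) ?_
    rcases hcase with rfl | ⟨h, hh, h0⟩
    · rw [pow_one] at hu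
      exact le_rank_of_valuation_eq_one (hu ▸ hγ)
    · exact le_rank_of_charpoly_eq_X_pow_mul ((charpoly_map γ φ).trans hh) h0
  obtain ⟨S', T', hS', hT', hunit⟩ := exists_isSymm_isUnit_toBlocks₂₂ (γ.map φ) hrank hB₁ hB₂
  obtain ⟨S, hS, rfl⟩ := exists_isSymm_map_toZMod_eq hS'
  obtain ⟨T, hT, rfl⟩ := exists_isSymm_map_toZMod_eq hT'
  let I := (1 : Matrix (Fin g) (Fin g) ℤ_[p])
  set M := fromBlocks 1 0 S 1 * γ * fromBlocks 1 T 0 1 with hM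
  have hMγ : γ = fromBlocks 1 0 (-S) 1 * M * fromBlocks 1 (-T) 0 1 := by
    have h₁ : fromBlocks I 0 (-S) I * fromBlocks I 0 S I = 1 := by
      simp [I, fromBlocks_multiply]
    have h₂ : fromBlocks I T 0 I * fromBlocks I (-T) 0 I = 1 := by
      simp [I, fromBlocks_multiply]
    rw [hM, mul_assoc, mul_assoc, h₂, mul_one, ← mul_assoc, h₁, one_mul]
  have hMJ : Mᵀ * Jmat ℤ_[p] g * M = η • Jmat ℤ_[p] g := by
    rw [hM, similitude_mul (similitude_mul (similitude_lower hS) hγ) (similitude_upper hT), one_mul,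
      mul_one]
  have hE : IsUnit M.toBlocks₂₂.det := by
    rw [isUnit_iff_toZMod_ne_zero, RingHom.map_det, ← isUnit_iff_ne_zero, ← isUnit_iff_isUnit_det]
    convert hunit
    have : (fromBlocks 1 0 (S.map φ) 1 * γ.map φ * fromBlocks 1 (T.map φ) 0 1) = M.map φ := by
      rw [hM, ← RingHom.mapMatrix_apply φ (_ * _), map_mul, map_mul]
      simp [fromBlocks_map, φ]
    rw [this]
    rfl
  rw [← fromBlocks_toBlocks M] at hMJ
  obtain ⟨S₁, T₁, hS₁, hT₁, hdec⟩ := similitude_decomposition hη0 hE hMJ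
  rw [fromBlocks_toBlocks] at hdec
  refine ⟨fromBlocks 1 0 (-S) 1 * (fromBlocks 1 S₁ 0 1 *
      fromBlocks ((u : ℤ_[p]) • M.toBlocks₂₂ᵀ⁻¹) 0 0 M.toBlocks₂₂),
    mul_mem_GSpZp (fromBlocks_lower_mem_GSpZp hS.neg) (mul_mem_GSpZp
      (fromBlocks_upper_mem_GSpZp hS₁) (fromBlocks_diagonal_mem_GSpZp hE u)),
    fromBlocks 1 0 T₁ 1 * fromBlocks 1 (-T) 0 1,
    mul_mem_GSpZp (fromBlocks_lower_mem_GSpZp hT₁) (fromBlocks_upper_mem_GSpZp hT.neg), ?_⟩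
  have hD : fromBlocks M.toBlocks₂₂ᵀ⁻¹ 0 0 M.toBlocks₂₂ * fromBlocks (η • 1) 0 0 1 =
      fromBlocks ((u : ℤ_[p]) • M.toBlocks₂₂ᵀ⁻¹) 0 0 M.toBlocks₂₂ *
        fromBlocks (diagonal fun _ => (p : ℤ_[p]) ^ e) 0 0 1 := by
    rw [← smul_one_eq_diagonal, hu]
    simp [fromBlocks_multiply, smul_smul, mul_comm]
  conv_lhs => rw [hMγ, hdec, mul_assoc (fromBlocks 1 S₁ 0 1), hD]
  simp only [mul_assoc]
end

section
/- Let p be a prime, e ≥ 1, q = p^e, g ≥ 1, and n ≥ e. Let D_q ∈ Mat_{2g}(ℤ/pⁿℤ) be the diagonal matrix with g entries equal to q followed by g entries equal to 1. Then the number of matrices X ∈ Mat_{2g}(ℤ/pⁿℤ) such that (a) Xᵀ·J + J·X = c·J for some c ∈ ℤ/pⁿℤ, and (b) D_q·X = 0, is exactly q^{g(g+1)/2 + 1}. -/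
open Matrix

/-- A block matrix is an infinitesimal symplectic similitude killed by `diag(a, 1)` iff it is
`[[c, B], [0, 0]]` with `a c = 0`, `B` symmetric and `a B = 0`. -/
theorem similitude_and_diagonal_mul_eq_zero_iff {R : Type*} [CommRing R] {g : ℕ} [NeZero g] (a : R)
    (X : Matrix (Fin g ⊕ Fin g) (Fin g ⊕ Fin g) R) :
    ((∃ c : R, Xᵀ * Jmat R g + Jmat R g * X = c • Jmat R g) ∧
        fromBlocks (diagonal fun _ => a) 0 0 1 * X = 0) ↔
      ∃ (c : R) (B : Matrix (Fin g) (Fin g) R),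
        a * c = 0 ∧ (∀ i j, a * B i j = 0) ∧ B.IsSymm ∧ X = fromBlocks (c • 1) B 0 0 := by
  obtain ⟨A, B, C, D, rfl⟩ : ∃ A B C D, X = fromBlocks A B C D :=
    ⟨_, _, _, _, (fromBlocks_toBlocks X).symm⟩
  have hdiag : (diagonal fun _ : Fin g => a) = a • 1 := by
    rw [smul_one_eq_diagonal]
  simp only [Jmat, fromBlocks_transpose, fromBlocks_multiply, fromBlocks_add, fromBlocks_smul,
    hdiag, ← fromBlocks_zero, fromBlocks_inj, smul_mul, one_mul, zero_mul, mul_zero, mul_one,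
    add_zero, zero_add, mul_neg, neg_mul, smul_zero, Matrix.smul_mul]
  constructor
  · rintro ⟨⟨c, -, -, hA, hB⟩, haA, haB, rfl, rfl⟩
    have hA' : A = c • 1 := by simpa using hA
    subst hA'
    refine ⟨c, B, ?_, fun i j => ?_, ?_, rfl, rfl, rfl, rfl⟩
    · simpa using congr_fun₂ haA 0 0
    · simpa using congr_fun₂ haB i j
    · rw [neg_add_eq_zero] at hB
      exact hB
  · rintro ⟨c, B', hc, hB, hs, rfl, rfl, rfl, rfl⟩
    refine ⟨⟨c, ?_, ?_, ?_, ?_⟩, ?_, ?_, rfl, rfl⟩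
    · simp
    · simp
    · simp
    · simp [hs.eq]
    · rw [smul_smul, hc, zero_smul]
    · ext i j
      exact hB i j

/-- The infinitesimal symplectic similitudes killed by `diag(a, 1)` are parametrized by the
`a`-torsion scalars and the symmetric matrices with `a`-torsion entries. -/
theorem card_similitude_and_diagonal_mul_eq_zero {R : Type*} [CommRing R] (g : ℕ) [NeZero g] (a : R) :
    Nat.card {X : Matrix (Fin g ⊕ Fin g) (Fin g ⊕ Fin g) R |
        (∃ c : R, Xᵀ * Jmat R g + Jmat R g * X = c • Jmat R g) ∧
        fromBlocks (diagonal fun _ => a) 0 0 1 * X = 0} =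
      Nat.card ({x : R // a * x = 0} × (Sym2 (Fin g) → {x : R // a * x = 0})) := by
  symm
  refine Nat.card_eq_of_bijective (fun y => ⟨fromBlocks (y.1.1 • 1)
    (of fun i j => (y.2 s(i, j)).1) 0 0, ?_⟩) ⟨?_, ?_⟩
  · refine (similitude_and_diagonal_mul_eq_zero_iff a _).2
      ⟨_, _, y.1.2, fun i j => (y.2 s(i, j)).2, ?_, rfl⟩
    exact Matrix.IsSymm.ext fun i j => congrArg (fun s => (y.2 s).1) Sym2.eq_swap
  · rintro ⟨c, f⟩ ⟨c', f'⟩ h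
    simp only [Subtype.mk.injEq, fromBlocks_inj] at h
    refine Prod.ext (Subtype.ext ?_) (funext fun s => ?_)
    · simpa using congr_fun₂ h.1 0 0
    · induction s with
      | h i j => exact Subtype.ext (congr_fun₂ h.2.1 i j)
  · rintro ⟨X, hX⟩
    obtain ⟨c, B, hc, hB, hs, rfl⟩ := (similitude_and_diagonal_mul_eq_zero_iff a X).1 hX
    exact ⟨⟨⟨c, hc⟩, Sym2.lift ⟨fun i j => ⟨B i j, hB i j⟩,
      fun i j => Subtype.ext (hs.apply j i)⟩⟩, rfl⟩

/-- For `d ∣ m`, the `d`-torsion of `ZMod m` has `d` elements. -/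
theorem ZMod.card_natCast_mul_eq_zero {m d : ℕ} [NeZero m] (h : d ∣ m) :
    Nat.card {x : ZMod m // (d : ZMod m) * x = 0} = d := by
  have hker := IsAddCyclic.card_nsmulAddMonoidHom_ker (G := ZMod m) d
  rw [Nat.card_zmod, Nat.gcd_eq_right h] at hker
  refine Eq.trans (Nat.card_congr (Equiv.subtypeEquivRight fun x => ?_)) hker
  simp [AddMonoidHom.mem_ker]

/-- the key count in Lemma 4.9, `lem:SO-geom`, of the paper:
the number of mod `pⁿ` points `X` of the Lie algebra `𝔤𝔰𝔭_{2g}` killed by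
`diag(q,…,q,1,…,1)` (with `q = pᵉ`, `n ≥ e`) is `q^{g(g+1)/2 + 1}`. -/
theorem statement9 (p : ℕ) [Fact p.Prime] (e g n : ℕ)
    (he : 1 ≤ e) (hg : 1 ≤ g) (hn : e ≤ n) :
    Nat.card {X : Matrix (Fin g ⊕ Fin g) (Fin g ⊕ Fin g) (ZMod (p ^ n)) |
        (∃ c : ZMod (p ^ n),
          Xᵀ * Jmat (ZMod (p ^ n)) g + Jmat (ZMod (p ^ n)) g * X
            = c • Jmat (ZMod (p ^ n)) g) ∧
        Matrix.fromBlocks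
            (Matrix.diagonal fun _ => ((p : ZMod (p ^ n))) ^ e) 0 0 1 * X = 0}
      = (p ^ e) ^ (g * (g + 1) / 2 + 1) := by
  have : NeZero g := ⟨Nat.one_le_iff_ne_zero.1 hg⟩
  have : NeZero (p ^ n) := ⟨pow_ne_zero _ (Fact.out : p.Prime).ne_zero⟩
  have hcard := ZMod.card_natCast_mul_eq_zero (pow_dvd_pow p hn)
  rw [Nat.cast_pow] at hcard
  rw [card_similitude_and_diagonal_mul_eq_zero, Nat.card_prod, Nat.card_fun, hcard,
    Nat.card_eq_fintype_card, Sym2.card, Fintype.card_fin, Nat.choose_two_right,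
    Nat.add_sub_cancel, mul_comm (g + 1), pow_succ']
end

section
/- Let F be a field, g ≥ 1, and let λ₀, λ₁, …, λ_g ∈ F be nonzero. For 1 ≤ i < j ≤ g set α_{ij} = (λ_i − λ_j)·(λ_i − λ₀/λ_j)·(λ₀/λ_i − λ_j)·(λ₀/λ_i − λ₀/λ_j), β_{ij} = (λ_i + λ₀/λ_i) − (λ_j + λ₀/λ_j), and δ_{ij} = (1 − λ_i/λ_j)·(1 − λ_j/λ_i)·(1 − λ_iλ_j/λ₀)·(1 − λ₀/(λ_iλ_j)); and for 1 ≤ i ≤ g set α_i = λ_i − λ₀/λ_i and δ_i = (1 − λ_i²/λ₀)·(1 − λ₀/λ_i²). Then ∏_{1≤i<j≤g} α_{ij}² · ∏_{1≤i≤g} α_i² = (−1)^g · λ₀^{g(3g−1)/2} · ( ∏_{1≤i<j≤g} δ_{ij} · ∏_{1≤i≤g} δ_i ) · ∏_{1≤i<j≤g} β_{ij}². -/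
/-- The number of pairs `i < j` in `Fin n` is `n.choose 2`. -/
theorem Fin.card_filter_fst_lt_snd (n : ℕ) :
    (Finset.univ.filter (fun q : Fin n × Fin n => q.1 < q.2)).card = n.choose 2 := by
  rw [Finset.card_filter, Fintype.sum_prod_type_right]
  simp_rw [← Finset.card_filter, Finset.filter_gt_eq_Iio, Fin.card_Iio]
  rw [Fin.sum_univ_eq_sum_range (fun i => i), Finset.sum_range_id, Nat.choose_two_right]

theorem sq_sub_div_self_eq {F : Type*} [Field F] {c x : F} (hc : c ≠ 0) (hx : x ≠ 0) :
    (x - c / x) ^ 2 = -1 * c * ((1 - x ^ 2 / c) * (1 - c / x ^ 2)) := by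
  field_simp
  ring

theorem sq_prod_sub_conj_eq {F : Type*} [Field F] {c x y : F} (hc : c ≠ 0) (hx : x ≠ 0)
    (hy : y ≠ 0) :
    ((x - y) * (x - c / y) * (c / x - y) * (c / x - c / y)) ^ 2 =
      c ^ 3 * ((1 - x / y) * (1 - y / x) * (1 - x * y / c) * (1 - c / (x * y))) *
        ((x + c / x) - (y + c / y)) ^ 2 := by
  field_simp
  ring

theorem Nat.three_mul_choose_two_add_self (n : ℕ) :
    3 * n.choose 2 + n = n * (3 * n - 1) / 2 := by
  have key : 2 * n.choose 2 = n * (n - 1) := by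
    rw [Nat.choose_two_right, Nat.mul_div_cancel' (Nat.even_mul_pred_self n).two_dvd]
  rcases n with _ | k
  · rfl
  · have : (k + 1) * (3 * (k + 1) - 1) = 2 * (3 * (k + 1).choose 2 + (k + 1)) := by
      rw [show 3 * (k + 1) - 1 = 3 * k + 2 by omega]
      rw [Nat.add_sub_cancel] at key
      linarith
    omega

/-- Lemma of §6.1.3 of the paper: the algebraic identity
`disc(f) = (−1)^g · λ₀^{g(3g−1)/2} · D(γ₀) · disc(f⁺)` among the quantities
`α_{ij}, α_i, β_{ij}, δ_{ij}, δ_i` built from nonzero elements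
`λ₀, λ₁, …, λ_g` of a field. -/
theorem statement10 {F : Type*} [Field F] (g : ℕ) (hg : 1 ≤ g)
    (lam0 : F) (lam : Fin g → F) (h0 : lam0 ≠ 0) (h : ∀ i, lam i ≠ 0) :
    (∏ q ∈ Finset.univ.filter (fun q : Fin g × Fin g => q.1 < q.2),
        ((lam q.1 - lam q.2) * (lam q.1 - lam0 / lam q.2) *
          (lam0 / lam q.1 - lam q.2) * (lam0 / lam q.1 - lam0 / lam q.2)) ^ 2) *
      ∏ i : Fin g, (lam i - lam0 / lam i) ^ 2
    = (-1 : F) ^ g * lam0 ^ (g * (3 * g - 1) / 2) *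
      ((∏ q ∈ Finset.univ.filter (fun q : Fin g × Fin g => q.1 < q.2),
          ((1 - lam q.1 / lam q.2) * (1 - lam q.2 / lam q.1) *
            (1 - lam q.1 * lam q.2 / lam0) * (1 - lam0 / (lam q.1 * lam q.2)))) *
        ∏ i : Fin g, ((1 - (lam i) ^ 2 / lam0) * (1 - lam0 / (lam i) ^ 2))) *
      ∏ q ∈ Finset.univ.filter (fun q : Fin g × Fin g => q.1 < q.2),
        ((lam q.1 + lam0 / lam q.1) - (lam q.2 + lam0 / lam q.2)) ^ 2 := by
  rw [Finset.prod_congr rfl fun q _ => sq_prod_sub_conj_eq h0 (h q.1) (h q.2),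
    Finset.prod_congr rfl fun i _ => sq_sub_div_self_eq h0 (h i),
    ← Nat.three_mul_choose_two_add_self]
  simp only [Finset.prod_mul_distrib, Finset.prod_const, Fin.card_filter_fst_lt_snd,
    Finset.card_univ, Fintype.card_fin, pow_add, pow_mul]
  ring
end

section
/- Let g ≥ 1 and let G be a group together with a transitive action of G on the index set {1, …, g}. Let L = {a : {1, …, g} → ℤ : Σᵢ a(i) = 0}, regarded as a G-module via (σ·a)(i) = a(σ⁻¹·i). Consider the induced G-action on the quotient L/2L. Then: if g is odd, the only G-fixed element of L/2L is 0; if g is even, L/2L has exactly two G-fixed elements, and the nonzero fixed element is the class of any vector in L all of whose coordinates are odd (such vectors exist, e.g. the vector with g/2 entries equal to 1 and g/2 entries equal to −1, and they all represent the same class modulo 2L). -/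
/-- A zero-sum integer vector with even coordinates is twice a zero-sum integer vector. -/
theorem exists_sum_eq_zero_and_eq_two_mul {ι : Type*} [Fintype ι] {a : ι → ℤ}
    (hsum : ∑ i, a i = 0) (heven : ∀ i, Even (a i)) :
    ∃ c : ι → ℤ, (∑ i, c i) = 0 ∧ ∀ i, a i = 2 * c i := by
  choose c hc using fun i => (heven i).two_dvd
  refine ⟨c, ?_, hc⟩
  simp only [hc, ← Finset.mul_sum] at hsum
  lia

/-- If the parities of the coordinates of an integer vector are invariant under a transitive
action on the indices, then all of them coincide. -/
theorem forall_even_or_forall_odd_of_isPretransitive {G ι : Type*} [Group G] [MulAction G ι]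
    [MulAction.IsPretransitive G ι] {a : ι → ℤ} (h : ∀ (σ : G) (i : ι), Even (a (σ⁻¹ • i) - a i)) :
    (∀ i, Even (a i)) ∨ ∀ i, Odd (a i) := by
  have parity (i j : ι) : Even (a j) ↔ Even (a i) := by
    obtain ⟨σ, rfl⟩ := MulAction.exists_smul_eq G i j
    simpa using Int.even_sub.mp (h σ⁻¹ i)
  by_contra! ⟨⟨i, hi⟩, j, hj⟩
  exact hi ((parity i j).mp (Int.not_odd_iff_even.mp hj))

/-- A zero-sum integer vector with odd coordinates has an even number of coordinates. -/
theorem even_card_of_sum_eq_zero_of_odd {ι : Type*} [Fintype ι] {a : ι → ℤ}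
    (hsum : ∑ i, a i = 0) (hodd : ∀ i, Odd (a i)) : Even (Fintype.card ι) := by
  have h := Finset.even_sum (s := Finset.univ) (fun i => a i - 1) fun i _ =>
    (hodd i).sub_odd odd_one
  simpa [Finset.sum_sub_distrib, hsum] using h


/-- key combinatorial step in the proof of Lemma A,
`lem:spec_h1`, of the Appendix.  `G` acts transitively on the `g`
coordinates; `L` is the lattice of zero-sum integer vectors, with
`(σ • a) i = a (σ⁻¹ • i)`.  A class of `L/2L` is `G`-fixed iff some
(equivalently, any) representative `a` satisfies `σ•a − a ∈ 2L` for all `σ`;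
membership in `2L` means `a = 2c` with `c` zero-sum.  If `g` is odd the only
fixed class is `0`; if `g` is even there are exactly two fixed classes, the
nonzero one being the class of any all-odd zero-sum vector. -/
theorem statement11 {G : Type*} [Group G] (g : ℕ) (hg : 1 ≤ g)
    [MulAction G (Fin g)] [MulAction.IsPretransitive G (Fin g)] :
    (Odd g → ∀ a : Fin g → ℤ, (∑ i, a i) = 0 →
      (∀ σ : G, ∃ b : Fin g → ℤ, (∑ i, b i) = 0 ∧ ∀ i, a (σ⁻¹ • i) - a i = 2 * b i) →
      ∃ c : Fin g → ℤ, (∑ i, c i) = 0 ∧ ∀ i, a i = 2 * c i) ∧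
    (Even g →
      (∃ a : Fin g → ℤ, (∑ i, a i) = 0 ∧ ∀ i, Odd (a i)) ∧
      (∀ a : Fin g → ℤ, (∑ i, a i) = 0 → (∀ i, Odd (a i)) →
        (∀ σ : G, ∃ b : Fin g → ℤ, (∑ i, b i) = 0 ∧ ∀ i, a (σ⁻¹ • i) - a i = 2 * b i) ∧
        ¬ ∃ c : Fin g → ℤ, (∑ i, c i) = 0 ∧ ∀ i, a i = 2 * c i) ∧
      (∀ a a' : Fin g → ℤ, (∑ i, a i) = 0 → (∑ i, a' i) = 0 →
        (∀ i, Odd (a i)) → (∀ i, Odd (a' i)) →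
        ∃ c : Fin g → ℤ, (∑ i, c i) = 0 ∧ ∀ i, a i - a' i = 2 * c i) ∧
      (∀ a : Fin g → ℤ, (∑ i, a i) = 0 →
        (∀ σ : G, ∃ b : Fin g → ℤ, (∑ i, b i) = 0 ∧ ∀ i, a (σ⁻¹ • i) - a i = 2 * b i) →
        (∃ c : Fin g → ℤ, (∑ i, c i) = 0 ∧ ∀ i, a i = 2 * c i) ∨ (∀ i, Odd (a i)))) := by
  have hpar (a : Fin g → ℤ) (hfix : ∀ σ : G, ∃ b : Fin g → ℤ,
      (∑ i, b i) = 0 ∧ ∀ i, a (σ⁻¹ • i) - a i = 2 * b i) :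
      (∀ i, Even (a i)) ∨ ∀ i, Odd (a i) :=
    forall_even_or_forall_odd_of_isPretransitive fun σ i => by
      obtain ⟨b, -, hb⟩ := hfix σ
      simp [hb i]
  refine ⟨fun hodd a ha hfix => ?_, fun heven => ⟨?_, fun a ha hao => ⟨fun σ => ?_, ?_⟩,
    fun a a' ha ha' hao hao' => ?_, fun a ha hfix => ?_⟩⟩
  · rcases hpar a hfix with h | h
    · exact exists_sum_eq_zero_and_eq_two_mul ha h
    · have hcard := even_card_of_sum_eq_zero_of_odd ha h
      rw [Fintype.card_fin] at hcard
      exact absurd hcard (Nat.not_even_iff_odd.mpr hodd)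
  · refine ⟨fun i => (-1) ^ (i : ℕ), ?_, fun i => odd_neg_one.pow⟩
    rw [Fin.sum_univ_eq_sum_range (fun i => (-1 : ℤ) ^ i), neg_one_geom_sum, if_pos heven]
  · refine exists_sum_eq_zero_and_eq_two_mul ?_ fun i => (hao _).sub_odd (hao i)
    rw [Finset.sum_sub_distrib, ha, sub_zero, ← ha]
    exact Equiv.sum_comp (MulAction.toPerm σ⁻¹) a
  · rintro ⟨c, -, hc⟩
    have h := hao ⟨0, hg⟩
    simp [hc, ← Int.not_even_iff_odd] at h
  · exact exists_sum_eq_zero_and_eq_two_mul (by simp [ha, ha']) fun i => (hao i).sub_odd (hao' i)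
  · exact (hpar a hfix).imp_left (exists_sum_eq_zero_and_eq_two_mul ha)
end

section
/- Let p be a prime, e ≥ 1, g ≥ 1. Let γ ∈ Mat_{2g}(ℤ_p) satisfy γᵀ·J·γ = η·J for some η ∈ ℤ_p with v_p(η) = e, and assume the reduction modulo p of the characteristic polynomial of γ equals T^g·h(T) with h(0) ≠ 0 (the ordinary condition). Set β = η·γ⁻¹; then β = J⁻¹·γᵀ·J lies in Mat_{2g}(ℤ_p). Let W = ℤ_p^{2g}, W⁰ = ⋂_{n≥1} γⁿ·W, and W¹ = ⋂_{n≥1} βⁿ·W. Then W = W⁰ ⊕ W¹; both W⁰ and W¹ are free ℤ_p-submodules of rank g stable under γ; γ restricts to a ℤ_p-linear automorphism of W⁰; and both W⁰ and W¹ are totally isotropic for the symplectic pairing (x, y) ↦ xᵀ·J·y. -/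
open Matrix

/-- `β = J⁻¹·γᵀ·J`, the integral incarnation of `η·γ⁻¹`. -/
noncomputable def betaMat (p : ℕ) [Fact p.Prime] (g : ℕ)
    (γ : Matrix (Fin g ⊕ Fin g) (Fin g ⊕ Fin g) ℤ_[p]) :
    Matrix (Fin g ⊕ Fin g) (Fin g ⊕ Fin g) ℤ_[p] :=
  (Jmat ℤ_[p] g)⁻¹ * γᵀ * Jmat ℤ_[p] g

/-- `W⁰ = ⋂_{n ≥ 1} γⁿ·W`, the "étale part". -/
noncomputable def W0 (p : ℕ) [Fact p.Prime] (g : ℕ)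
    (γ : Matrix (Fin g ⊕ Fin g) (Fin g ⊕ Fin g) ℤ_[p]) :
    Submodule ℤ_[p] (Fin g ⊕ Fin g → ℤ_[p]) :=
  ⨅ (n : ℕ) (_ : 1 ≤ n), LinearMap.range (Matrix.mulVecLin (γ ^ n))

/-- `W¹ = ⋂_{n ≥ 1} βⁿ·W`, the "toric part". -/
noncomputable def W1 (p : ℕ) [Fact p.Prime] (g : ℕ)
    (γ : Matrix (Fin g ⊕ Fin g) (Fin g ⊕ Fin g) ℤ_[p]) :
    Submodule ℤ_[p] (Fin g ⊕ Fin g → ℤ_[p]) :=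
  ⨅ (n : ℕ) (_ : 1 ≤ n), LinearMap.range (Matrix.mulVecLin ((betaMat p g γ) ^ n))

section CoprimePowers

variable {A : Type*} [Ring A] {a b : A}

open scoped IsMulCommutative in
/-- Powers of two commuting elements with invertible sum are comaximal. -/
theorem exists_pow_mul_add_pow_mul_eq_one (hab : Commute a b) (hs : IsUnit (a + b)) (n : ℕ) :
    ∃ u v : A, Commute a u ∧ Commute b u ∧ Commute a v ∧ Commute b v ∧
      a ^ n * u + b ^ n * v = 1 := by
  obtain ⟨s, hs⟩ := hs
  have ha : Commute a (↑s⁻¹ : A) :=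
    Commute.units_inv_right (by rw [hs]; exact (Commute.refl a).add_right hab)
  have hb : Commute b (↑s⁻¹ : A) :=
    Commute.units_inv_right (by rw [hs]; exact hab.symm.add_right (Commute.refl b))
  let S : Set A := {a, b, ↑s⁻¹}
  have hS : ∀ x ∈ S, ∀ y ∈ S, x * y = y * x := by
    have h1 : ∀ x ∈ S, Commute x a ∧ Commute x b ∧ Commute x (↑s⁻¹ : A) := by
      rintro x (rfl | rfl | rfl)
      exacts [⟨.refl _, hab, ha⟩, ⟨hab.symm, .refl _, hb⟩, ⟨ha.symm, hb.symm, .refl _⟩]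
    rintro x hx y (rfl | rfl | rfl)
    exacts [(h1 x hx).1, (h1 x hx).2.1, (h1 x hx).2.2]
  have := Algebra.isMulCommutative_adjoin ℤ hS
  let a' : Algebra.adjoin ℤ S := ⟨a, Algebra.subset_adjoin (by simp [S])⟩
  let b' : Algebra.adjoin ℤ S := ⟨b, Algebra.subset_adjoin (by simp [S])⟩
  let t' : Algebra.adjoin ℤ S := ⟨↑s⁻¹, Algebra.subset_adjoin (by simp [S])⟩
  have hco : IsCoprime a' b' := by
    refine ⟨t', t', Subtype.ext ?_⟩
    change (↑s⁻¹ : A) * a + ↑s⁻¹ * b = 1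
    rw [← mul_add, ← hs, Units.inv_mul]
  obtain ⟨u, v, huv⟩ := hco.pow (m := n) (n := n)
  refine ⟨u, v, congrArg Subtype.val (mul_comm a' u), congrArg Subtype.val (mul_comm b' u),
    congrArg Subtype.val (mul_comm a' v), congrArg Subtype.val (mul_comm b' v), ?_⟩
  rw [mul_comm u, mul_comm v] at huv
  exact congrArg Subtype.val huv

end CoprimePowers

section StableRange

variable {R M : Type*} [CommRing R] [AddCommGroup M] [Module R M]

/-- On a compact module, if the ranges of `fⁿ` and `bⁿ` span for all `n`, then so do
the stable ranges of `f` and `b`. -/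
theorem codisjoint_iInf_range_pow [TopologicalSpace M] [IsTopologicalAddGroup M]
    [CompactSpace M] [T2Space M] {f b : Module.End R M} (hf : Continuous f) (hb : Continuous b)
    (h : ∀ n, LinearMap.range (f ^ n) ⊔ LinearMap.range (b ^ n) = ⊤) :
    Codisjoint (⨅ n, LinearMap.range (f ^ n)) (⨅ n, LinearMap.range (b ^ n)) := by
  have hclosed : ∀ {k : Module.End R M}, Continuous k → ∀ n,
      IsClosed (LinearMap.range (k ^ n) : Set M) := fun {k} hk n ↦ by
    rw [LinearMap.coe_range, Module.End.coe_pow]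
    exact (isCompact_range (hk.iterate n)).isClosed
  have hanti : ∀ (k : Module.End R M) n,
      LinearMap.range (k ^ (n + 1)) ≤ LinearMap.range (k ^ n) := fun k n ↦ by
    rw [pow_succ]
    exact LinearMap.range_comp_le_range _ _
  rw [Submodule.codisjoint_iff_exists_add_eq]
  intro x
  let K : ℕ → Set M := fun n ↦
    LinearMap.range (f ^ n) ∩ (fun y ↦ x - y) ⁻¹' LinearMap.range (b ^ n)
  have hK : ∀ n, IsClosed (K n) := fun n ↦
    (hclosed hf n).inter ((hclosed hb n).preimage (by fun_prop))
  obtain ⟨y, hy⟩ := IsCompact.nonempty_iInter_of_sequence_nonempty_isCompact_isClosed K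
    (fun n y hy ↦ ⟨hanti f n hy.1, hanti b n hy.2⟩)
    (fun n ↦ by
      obtain ⟨y, hy, z, hz, rfl⟩ := Submodule.mem_sup.1 ((h n).symm ▸ Submodule.mem_top : x ∈ _)
      exact ⟨y, hy, by simpa using hz⟩)
    (hK 0).isCompact hK
  rw [Set.mem_iInter] at hy
  exact ⟨y, x - y, (Submodule.mem_iInf _).2 fun n ↦ (hy n).1,
    (Submodule.mem_iInf _).2 fun n ↦ (hy n).2, by abel⟩

/-- If `f` and `b` commute and have invertible sum, then the ranges of `fⁿ` and `bⁿ` span. -/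
theorem range_pow_sup_range_pow {f b : Module.End R M} (hfb : Commute f b) (hs : IsUnit (f + b))
    (n : ℕ) : LinearMap.range (f ^ n) ⊔ LinearMap.range (b ^ n) = ⊤ := by
  obtain ⟨u, v, -, -, -, -, huv⟩ := exists_pow_mul_add_pow_mul_eq_one hfb hs n
  refine eq_top_iff.2 fun x _ ↦ Submodule.mem_sup.2
    ⟨(f ^ n) (u x), ⟨_, rfl⟩, (b ^ n) (v x), ⟨_, rfl⟩, ?_⟩
  exact DFunLike.congr_fun huv x

/-- If `f` and `b` have product `η` and invertible sum, then the stable ranges of `f` and `b`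
meet trivially as soon as `M` is `η`-adically separated. -/
theorem disjoint_iInf_range_pow {f b : Module.End R M} {η : R} (hfb : f * b = η • 1)
    (hbf : b * f = η • 1) (hs : IsUnit (f + b))
    (hsep : ∀ x : M, (∀ n : ℕ, ∃ y, η ^ n • y = x) → x = 0) :
    Disjoint (⨅ n, LinearMap.range (f ^ n)) (⨅ n, LinearMap.range (b ^ n)) := by
  have hc : Commute f b := hfb.trans hbf.symm
  rw [Submodule.disjoint_def]
  intro x hx hx'
  rw [Submodule.mem_iInf] at hx hx'
  refine hsep x fun n ↦ ?_
  obtain ⟨u, v, hfu, -, -, hbv, huv⟩ := exists_pow_mul_add_pow_mul_eq_one hc hs n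
  obtain ⟨y, hy⟩ := hx n
  obtain ⟨z, hz⟩ := hx' n
  have hpow : f ^ n * b ^ n = η ^ n • 1 := by rw [← hc.mul_pow, hfb, smul_pow, one_pow]
  have hpow' : b ^ n * f ^ n = η ^ n • 1 := by rw [← hc.symm.mul_pow, hbf, smul_pow, one_pow]
  refine ⟨u z + v y, ?_⟩
  have h1 : (f ^ n * u) x = η ^ n • u z := by
    rw [(hfu.pow_left n).eq, ← hz, ← Module.End.mul_apply, mul_assoc, hpow]
    simp
  have h2 : (b ^ n * v) x = η ^ n • v y := by
    rw [(hbv.pow_left n).eq, ← hy, ← Module.End.mul_apply, mul_assoc, hpow']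
    simp
  rw [smul_add, ← h1, ← h2, ← LinearMap.add_apply, huv, Module.End.one_apply]

/-- Endomorphisms commuting with `k` preserve the stable range of `k`. -/
theorem apply_mem_iInf_range_pow {f k : Module.End R M} (h : Commute f k) {x : M}
    (hx : x ∈ ⨅ n, LinearMap.range (k ^ n)) : f x ∈ ⨅ n, LinearMap.range (k ^ n) := by
  rw [Submodule.mem_iInf] at hx ⊢
  intro n
  obtain ⟨y, rfl⟩ := hx n
  exact ⟨f y, DFunLike.congr_fun (h.pow_right n).eq.symm y⟩

/-- If the stable ranges of commuting `f` and `b` are complementary, then `f` maps its stable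
range onto itself. -/
theorem map_iInf_range_pow {f b : Module.End R M} (h : Commute f b)
    (hc : IsCompl (⨅ n, LinearMap.range (f ^ n)) (⨅ n, LinearMap.range (b ^ n))) :
    Submodule.map f (⨅ n, LinearMap.range (f ^ n)) = ⨅ n, LinearMap.range (f ^ n) := by
  refine le_antisymm
    (Submodule.map_le_iff_le_comap.2 fun x ↦ apply_mem_iInf_range_pow (.refl f)) fun x hx ↦ ?_
  obtain ⟨y, rfl⟩ : ∃ y, f y = x := by simpa using (Submodule.mem_iInf _).1 hx 1
  obtain ⟨y, z, hy, hz, rfl⟩ := Submodule.codisjoint_iff_exists_add_eq.1 hc.codisjoint y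
  have hz' : f z = 0 := by
    refine Submodule.disjoint_def.1 hc.disjoint _ ?_ (apply_mem_iInf_range_pow h hz)
    simpa using sub_mem hx (apply_mem_iInf_range_pow (.refl f) hy)
  exact ⟨y, hy, by simp [hz']⟩

/-- The stable range of a similitude with multiplier `η` is totally isotropic as soon as `R` is
`η`-adically separated. -/
theorem isotropic_iInf_range_pow {B : M →ₗ[R] M →ₗ[R] R} {k : Module.End R M} {η : R}
    (hk : ∀ x y, B (k x) (k y) = η * B x y) (hsep : ∀ r : R, (∀ n : ℕ, η ^ n ∣ r) → r = 0)
    {x y : M} (hx : x ∈ ⨅ n, LinearMap.range (k ^ n)) (hy : y ∈ ⨅ n, LinearMap.range (k ^ n)) :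
    B x y = 0 := by
  have hpow : ∀ (n : ℕ) x y, B ((k ^ n) x) ((k ^ n) y) = η ^ n * B x y := by
    intro n
    induction n with
    | zero => simp
    | succ n ih => intro x y; rw [pow_succ', Module.End.mul_apply, Module.End.mul_apply, hk, ih,
        pow_succ', mul_assoc]
  rw [Submodule.mem_iInf] at hx hy
  refine hsep _ fun n ↦ ?_
  obtain ⟨x, rfl⟩ := hx n
  obtain ⟨y, rfl⟩ := hy n
  exact ⟨_, hpow n x y⟩

end StableRange

/-- A totally isotropic submodule for a nondegenerate form has rank at most that of any
complement. -/
theorem finrank_le_of_isotropic {R M : Type*} [CommRing R] [StrongRankCondition R]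
    [AddCommGroup M] [Module R M]
    {U V : Submodule R M} [Module.Free R V] [Module.Finite R V] {B : M →ₗ[R] M →ₗ[R] R}
    (hB : B.SeparatingLeft) (hUV : Codisjoint U V) (hU : ∀ x ∈ U, ∀ y ∈ U, B x y = 0) :
    Module.finrank R U ≤ Module.finrank R V := by
  rw [← Module.finrank_linearMap_self R R V]
  refine LinearMap.finrank_le_finrank_of_injective (f := B.domRestrict₁₂ U V)
    ((injective_iff_map_eq_zero _).2 fun x hx ↦ Subtype.ext (hB _ fun y ↦ ?_))
  obtain ⟨u, v, hu, hv, rfl⟩ := Submodule.codisjoint_iff_exists_add_eq.1 hUV y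
  rw [map_add, hU _ x.2 _ hu, zero_add]
  exact DFunLike.congr_fun hx ⟨v, hv⟩

/-- If `A * B = 0` then `χ_A * χ_B = X ^ #n * χ_{A + B}`. -/
theorem Matrix.charpoly_mul_charpoly_of_mul_eq_zero {n R : Type*} [Fintype n] [DecidableEq n]
    [CommRing R] {A B : Matrix n n R} (h : A * B = 0) :
    A.charpoly * B.charpoly = Polynomial.X ^ Fintype.card n * (A + B).charpoly := by
  have h' : A.charmatrix * B.charmatrix =
      (Polynomial.X : Polynomial R) • (A + B).charmatrix := by
    have hC : (Polynomial.C : R →+* _).mapMatrix A * (Polynomial.C : R →+* _).mapMatrix B = 0 := by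
      rw [← map_mul, h, map_zero]
    simp only [charmatrix, ← smul_one_eq_diagonal, scalar_apply, map_add] at hC ⊢
    simp only [sub_mul, mul_sub, hC, smul_mul_assoc, mul_smul_comm, one_mul, mul_one, smul_sub,
      smul_add]
    abel
  rw [charpoly, charpoly, ← det_mul, h', det_smul, charpoly]

section Similitude

variable {R : Type*} [CommRing R] {g : ℕ}
  {γ : Matrix (Fin g ⊕ Fin g) (Fin g ⊕ Fin g) R} {η : R}

theorem Jmat_eq_J : Jmat R g = Matrix.J (Fin g) R := rfl

theorem isUnit_det_Jmat : IsUnit (Jmat R g).det := Matrix.isUnit_det_J _ _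

theorem Jmat_conj_mul (hγ : γᵀ * Jmat R g * γ = η • Jmat R g) :
    (Jmat R g)⁻¹ * γᵀ * Jmat R g * γ = η • 1 := by
  rw [mul_assoc, mul_assoc, ← mul_assoc γᵀ, hγ, mul_smul_comm,
    Matrix.nonsing_inv_mul _ isUnit_det_Jmat]

theorem mul_Jmat_conj [IsDomain R] (hη : η ≠ 0) (hγ : γᵀ * Jmat R g * γ = η • Jmat R g) :
    γ * ((Jmat R g)⁻¹ * γᵀ * Jmat R g) = η • 1 := by
  have h := Jmat_conj_mul hγ
  have hdet : γ.det ≠ 0 := by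
    intro h0
    have := congrArg Matrix.det h
    rw [Matrix.det_mul, h0, mul_zero, Matrix.det_smul, Matrix.det_one, mul_one] at this
    exact pow_ne_zero _ hη this.symm
  have h0 : (γ * ((Jmat R g)⁻¹ * γᵀ * Jmat R g) - η • 1) * γ = 0 := by
    rw [sub_mul, mul_assoc, h, mul_smul_comm, smul_mul_assoc, mul_one, one_mul, sub_self]
  have h1 := congrArg (· * γ.adjugate) h0
  simp only [mul_assoc _ γ, Matrix.mul_adjugate, mul_smul_comm, mul_one, zero_mul] at h1
  exact sub_eq_zero.1 ((smul_eq_zero.1 h1).resolve_left hdet)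

theorem charpoly_Jmat_conj : ((Jmat R g)⁻¹ * γᵀ * Jmat R g).charpoly = γ.charpoly := by
  obtain ⟨u, hu⟩ := (Matrix.isUnit_iff_isUnit_det _).2 (isUnit_det_Jmat (R := R) (g := g))
  rw [← hu, Matrix.charpoly_units_conj', Matrix.charpoly_transpose]

theorem Jmat_conj_similitude (h : γ * ((Jmat R g)⁻¹ * γᵀ * Jmat R g) = η • 1) :
    ((Jmat R g)⁻¹ * γᵀ * Jmat R g)ᵀ * Jmat R g * ((Jmat R g)⁻¹ * γᵀ * Jmat R g) =
      η • Jmat R g := by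
  have hT : ((Jmat R g)⁻¹ * γᵀ * Jmat R g)ᵀ * Jmat R g = Jmat R g * γ := by
    rw [Jmat_eq_J, Matrix.J_inv, Matrix.transpose_mul, Matrix.transpose_mul,
      Matrix.transpose_neg, Matrix.J_transpose, Matrix.transpose_transpose, neg_neg]
    simp [mul_assoc, Matrix.J_squared]
  rw [hT, mul_assoc, h, mul_smul_comm, mul_one]

end Similitude

section Padic

variable {p : ℕ} [Fact p.Prime] {g : ℕ} {γ : Matrix (Fin g ⊕ Fin g) (Fin g ⊕ Fin g) ℤ_[p]}
  {η : ℤ_[p]}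

theorem isUnit_add_betaMat (hη : ¬ IsUnit η)
    (hγβ : γ * betaMat p g γ = η • (1 : Matrix (Fin g ⊕ Fin g) (Fin g ⊕ Fin g) ℤ_[p]))
    (hord : ∃ h : Polynomial (ZMod p),
      (γ.charpoly).map (PadicInt.toZMod (p := p)) = Polynomial.X ^ g * h ∧ h.eval 0 ≠ 0) :
    IsUnit (γ + betaMat p g γ) := by
  obtain ⟨h, hh, h0⟩ := hord
  have hker : ∀ x : ℤ_[p], PadicInt.toZMod x = 0 ↔ ¬ IsUnit x := fun x ↦ by
    rw [← RingHom.mem_ker, PadicInt.ker_toZMod, IsLocalRing.mem_maximalIdeal, mem_nonunits_iff]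
  let φ : ℤ_[p] →+* ZMod p := PadicInt.toZMod
  have hmul : γ.map φ * (betaMat p g γ).map φ = 0 := by
    rw [← Matrix.map_mul, hγβ]
    ext i j
    simp [φ, (hker η).2 hη]
  have key := Matrix.charpoly_mul_charpoly_of_mul_eq_zero hmul
  have hsum : γ.map φ + (betaMat p g γ).map φ = (γ + betaMat p g γ).map φ :=
    (Matrix.map_add φ (map_add φ) _ _).symm
  have hβ : (betaMat p g γ).charpoly = γ.charpoly := charpoly_Jmat_conj
  rw [hsum, Matrix.charpoly_map, Matrix.charpoly_map, hβ, hh, Fintype.card_sum, Fintype.card_fin,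
    pow_add, mul_mul_mul_comm] at key
  have key' := mul_left_cancel₀ (by simp) key
  rw [Matrix.isUnit_iff_isUnit_det]
  by_contra hdet
  have hz : ((γ + betaMat p g γ).map φ).det = 0 := by
    rw [← RingHom.mapMatrix_apply, ← RingHom.map_det]
    exact (hker _).2 hdet
  rw [Matrix.det_eq_sign_charpoly_coeff, Polynomial.coeff_zero_eq_eval_zero, ← key'] at hz
  simp [h0] at hz

theorem PadicInt.eq_zero_of_forall_pow_dvd (hη : ¬ IsUnit η) {r : ℤ_[p]}
    (h : ∀ n : ℕ, η ^ n ∣ r) : r = 0 := by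
  by_contra hr
  obtain ⟨n, hn⟩ := FiniteMultiplicity.of_not_isUnit hη hr
  exact hn (h _)

theorem iInf_range_mulVecLin_pow {n R : Type*} [Fintype n] [DecidableEq n] [CommRing R]
    (A : Matrix n n R) :
    (⨅ (k : ℕ) (_ : 1 ≤ k), LinearMap.range (A ^ k).mulVecLin) =
      ⨅ k : ℕ, LinearMap.range (A.toLin' ^ k) := by
  refine le_antisymm (le_iInf fun k ↦ ?_) (le_iInf₂ fun k _ ↦ ?_)
  · rcases k with _ | k
    · rw [pow_zero, Module.End.one_eq_id, LinearMap.range_id]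
      exact le_top
    · exact (iInf₂_le (k + 1) (by omega)).trans_eq (by rw [← Matrix.toLin'_pow]; rfl)
  · exact (iInf_le _ k).trans_eq (by rw [← Matrix.toLin'_pow]; rfl)

end Padic

/-- integral slope decomposition for an ordinary similitude,
§6.3 of the paper: `W = W⁰ ⊕ W¹`, both summands are `γ`-stable free
`ℤ_p`-submodules of rank `g`, `γ` restricts to an automorphism of `W⁰`, and
both summands are totally isotropic for the symplectic pairing; moreover
`β := J⁻¹γᵀJ` is integral and satisfies `γ·β = η·1`, i.e. `β = η·γ⁻¹`. -/
theorem statement16 (p : ℕ) [Fact p.Prime] (e g : ℕ) (he : 1 ≤ e) (hg : 1 ≤ g)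
    (γ : Matrix (Fin g ⊕ Fin g) (Fin g ⊕ Fin g) ℤ_[p]) (η : ℤ_[p])
    (hγ : γᵀ * Jmat ℤ_[p] g * γ = η • Jmat ℤ_[p] g)
    (hval : η.valuation = (e : ℤ))
    (hord : ∃ h : Polynomial (ZMod p),
      (γ.charpoly).map (PadicInt.toZMod (p := p)) = Polynomial.X ^ g * h ∧
        h.eval 0 ≠ 0) :
    γ * betaMat p g γ = η • (1 : Matrix (Fin g ⊕ Fin g) (Fin g ⊕ Fin g) ℤ_[p]) ∧
    IsCompl (W0 p g γ) (W1 p g γ) ∧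
    Module.Free ℤ_[p] (W0 p g γ) ∧ Module.finrank ℤ_[p] (W0 p g γ) = g ∧
    Module.Free ℤ_[p] (W1 p g γ) ∧ Module.finrank ℤ_[p] (W1 p g γ) = g ∧
    (∀ x ∈ W0 p g γ, γ.mulVec x ∈ W0 p g γ) ∧
    (∀ x ∈ W1 p g γ, γ.mulVec x ∈ W1 p g γ) ∧
    Submodule.map (Matrix.mulVecLin γ) (W0 p g γ) = W0 p g γ ∧
    (∀ x ∈ W0 p g γ, ∀ y ∈ W0 p g γ, γ.mulVec x = γ.mulVec y → x = y) ∧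
    (∀ x ∈ W0 p g γ, ∀ y ∈ W0 p g γ, x ⬝ᵥ (Jmat ℤ_[p] g).mulVec y = 0) ∧
    (∀ x ∈ W1 p g γ, ∀ y ∈ W1 p g γ, x ⬝ᵥ (Jmat ℤ_[p] g).mulVec y = 0) := by
  have hη0 : η ≠ 0 := by
    rintro rfl
    simp at hval
    omega
  have hηu : ¬ IsUnit η := by
    rw [PadicInt.isUnit_iff, PadicInt.norm_eq_zpow_neg_valuation hη0, hval]
    have hp : (1 : ℝ) < p := mod_cast (Fact.out : p.Prime).one_lt
    exact (zpow_lt_one_of_neg₀ hp (by omega)).ne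
  have hγβ : γ * betaMat p g γ = η • 1 := mul_Jmat_conj hη0 hγ
  have hβγ : betaMat p g γ * γ = η • 1 := Jmat_conj_mul hγ
  have hβ : (betaMat p g γ)ᵀ * Jmat ℤ_[p] g * betaMat p g γ = η • Jmat ℤ_[p] g :=
    Jmat_conj_similitude hγβ
  have hW0 : W0 p g γ = ⨅ k : ℕ, LinearMap.range (γ.toLin' ^ k) := iInf_range_mulVecLin_pow γ
  have hW1 : W1 p g γ = ⨅ k : ℕ, LinearMap.range ((betaMat p g γ).toLin' ^ k) :=
    iInf_range_mulVecLin_pow _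
  have hfb : γ.toLin' * (betaMat p g γ).toLin' = η • 1 := by
    rw [Module.End.mul_eq_comp, ← Matrix.toLin'_mul, hγβ, map_smul, Matrix.toLin'_one]; rfl
  have hbf : (betaMat p g γ).toLin' * γ.toLin' = η • 1 := by
    rw [Module.End.mul_eq_comp, ← Matrix.toLin'_mul, hβγ, map_smul, Matrix.toLin'_one]; rfl
  have hs : IsUnit (γ.toLin' + (betaMat p g γ).toLin') := by
    rw [← map_add]
    exact (isUnit_add_betaMat hηu hγβ hord).map Matrix.toLinAlgEquiv'
  have hcomm : Commute γ.toLin' (betaMat p g γ).toLin' := hfb.trans hbf.symm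
  have hcont : ∀ A : Matrix (Fin g ⊕ Fin g) (Fin g ⊕ Fin g) ℤ_[p], Continuous A.toLin' :=
    fun A ↦ Continuous.matrix_mulVec continuous_const continuous_id
  have hcompl : IsCompl (W0 p g γ) (W1 p g γ) := by
    rw [hW0, hW1]
    refine ⟨disjoint_iInf_range_pow hfb hbf hs fun x hx ↦ funext fun i ↦
      PadicInt.eq_zero_of_forall_pow_dvd hηu fun n ↦ ?_,
      codisjoint_iInf_range_pow (hcont _) (hcont _) (range_pow_sup_range_pow hcomm hs)⟩
    obtain ⟨y, rfl⟩ := hx n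
    exact ⟨y i, rfl⟩
  let B : (Fin g ⊕ Fin g → ℤ_[p]) →ₗ[ℤ_[p]] (Fin g ⊕ Fin g → ℤ_[p]) →ₗ[ℤ_[p]] ℤ_[p] :=
    Matrix.toLinearMap₂' ℤ_[p] (Jmat ℤ_[p] g)
  have hB : ∀ x y, B x y = x ⬝ᵥ (Jmat ℤ_[p] g).mulVec y := Matrix.toLinearMap₂'_apply' _
  have hsim : ∀ A : Matrix (Fin g ⊕ Fin g) (Fin g ⊕ Fin g) ℤ_[p],
      Aᵀ * Jmat ℤ_[p] g * A = η • Jmat ℤ_[p] g →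
      ∀ x y, B (A.toLin' x) (A.toLin' y) = η * B x y := fun A hA x y ↦ by
    rw [hB, hB, Matrix.toLin'_apply, Matrix.toLin'_apply, Matrix.mulVec_mulVec,
      ← Matrix.vecMul_transpose, ← Matrix.dotProduct_mulVec, Matrix.mulVec_mulVec, ← mul_assoc,
      hA, Matrix.smul_mulVec, dotProduct_smul, smul_eq_mul]
  have hsep : B.SeparatingLeft :=
    LinearMap.separatingLeft_toLinearMap₂'_of_det_ne_zero' isUnit_det_Jmat.ne_zero
  have hiso0 : ∀ x ∈ W0 p g γ, ∀ y ∈ W0 p g γ, B x y = 0 := fun x hx y hy ↦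
    isotropic_iInf_range_pow (hsim _ hγ) (fun _ ↦ PadicInt.eq_zero_of_forall_pow_dvd hηu)
      (hW0 ▸ hx) (hW0 ▸ hy)
  have hiso1 : ∀ x ∈ W1 p g γ, ∀ y ∈ W1 p g γ, B x y = 0 := fun x hx y hy ↦
    isotropic_iInf_range_pow (hsim _ hβ) (fun _ ↦ PadicInt.eq_zero_of_forall_pow_dvd hηu)
      (hW1 ▸ hx) (hW1 ▸ hy)
  have hle := finrank_le_of_isotropic hsep hcompl.codisjoint hiso0
  have hge := finrank_le_of_isotropic hsep hcompl.symm.codisjoint hiso1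
  have hsum : Module.finrank ℤ_[p] (W0 p g γ) + Module.finrank ℤ_[p] (W1 p g γ) = g + g := by
    rw [← Module.finrank_prod, (Submodule.prodEquivOfIsCompl _ _ hcompl).finrank_eq]
    simp
  refine ⟨hγβ, hcompl, inferInstance, by omega, inferInstance, by omega, fun x hx ↦ ?_,
    fun x hx ↦ ?_, ?_, fun x _ y _ hxy ↦ ?_, fun x hx y hy ↦ hB x y ▸ hiso0 x hx y hy,
    fun x hx y hy ↦ hB x y ▸ hiso1 x hx y hy⟩
  · rw [hW0] at hx ⊢
    exact apply_mem_iInf_range_pow (.refl γ.toLin') hx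
  · rw [hW1] at hx ⊢
    exact apply_mem_iInf_range_pow hcomm hx
  · rw [hW0, hW1] at hcompl
    rw [hW0]
    exact map_iInf_range_pow hcomm hcompl
  · have := congrArg (betaMat p g γ).mulVec hxy
    simp only [Matrix.mulVec_mulVec, hβγ, Matrix.smul_mulVec, Matrix.one_mulVec] at this
    exact smul_right_injective _ hη0 this
end
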